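/- Let d ≥ 4 and r > 0 (note cap(A) ≤ cap(A,T) pointwise for every finite A ⊆ ℤ^d and T > 1). There exists C = C(d,r) < ∞ such that for all sufficiently large T: E^0[cap(X[0,T], rT) − cap(X[0,T])] ≤ C·T·log^{-3/2}T when d = 4, and E^0[cap(X[0,T], rT) − cap(X[0,T])] ≤ C·T^{3/4} when d ≥ 5. -/

import Mathlib

open MeasureTheory ProbabilityTheory Filter Topology
open scoped ENNReal NNReal Classical

noncomputable section

namespace FRIPaper

/-- The lattice `ℤ^d`. -/
abbrev Zd (d : ℕ) := Fin d → ℤ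

/-- `x` and `y` are nearest neighbours in `ℤ^d` (`ℓ¹`-distance one). -/
def IsNN {d : ℕ} (x y : Zd d) : Prop := (∑ i, (x i - y i).natAbs) = 1

/-- Event that a one-sided path never visits `A` at a positive time
(i.e. `H̃_A = ∞` for the path started anywhere). -/
def NoReturn {d : ℕ} (A : Set (Zd d)) : Set (ℕ → Zd d) := {ω | ∀ t : ℕ, 0 < t → ω t ∉ A}

/-- Event that a one-sided path does not visit `A` at a positive time `t ≤ s`
(i.e. `H̃_A > s`). -/
def NoReturnUpTo {d : ℕ} (A : Set (Zd d)) (s : ℝ) : Set (ℕ → Zd d) :=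
  {ω | ∀ t : ℕ, 0 < t → (t : ℝ) ≤ s → ω t ∉ A}

/-- Specification of the law `P^x` of the discrete-time simple random walk on `ℤ^d`
started at `x`, as a measure on the path space `ℕ → ℤ^d`: it is the unique probability
measure giving each nearest-neighbour cylinder of length `T` based at `x`
probability `(2d)^{-T}`. -/
def IsSRW (d : ℕ) (x : Zd d) (P : Measure (ℕ → Zd d)) : Prop :=
  IsProbabilityMeasure P ∧
    ∀ (T : ℕ) (w : ℕ → Zd d),
      P {ω | ∀ t ≤ T, ω t = w t} =
        if w 0 = x ∧ ∀ t < T, IsNN (w t) (w (t + 1)) then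
          (((2 * d : ℕ) : ℝ≥0∞))⁻¹ ^ T else 0

/-- A family `P x`, `x ∈ ℤ^d`, of simple random walk laws. -/
def IsSRWFamily (d : ℕ) (P : Zd d → Measure (ℕ → Zd d)) : Prop := ∀ x, IsSRW d x (P x)

/-- Equilibrium measure `e_A(x) = P^x[H̃_A = ∞] 1_{x ∈ A}`. -/
def equil {d : ℕ} (P : Zd d → Measure (ℕ → Zd d)) (A : Set (Zd d)) (x : Zd d) : ℝ :=
  if x ∈ A then (P x (NoReturn A)).toReal else 0

/-- Capacity `cap(A) = Σ_{x∈A} e_A(x)`. -/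
def capacity {d : ℕ} (P : Zd d → Measure (ℕ → Zd d)) (A : Finset (Zd d)) : ℝ :=
  ∑ x ∈ A, equil P (↑A) x

/-- Truncated capacity `cap(A,T) = Σ_{x∈A} P^x[H̃_A > T·(log T)^{-10}]`. -/
def capTrunc {d : ℕ} (P : Zd d → Measure (ℕ → Zd d)) (A : Finset (Zd d)) (T : ℝ) : ℝ :=
  ∑ x ∈ A, (P x (NoReturnUpTo (↑A) (T / (Real.log T) ^ (10 : ℕ)))).toReal

/-- `X[a,b]`, the set of points visited by the path between times `a` and `b`. -/
def walkRange {d : ℕ} (ω : ℕ → Zd d) (a b : ℕ) : Finset (Zd d) := (Finset.Icc a b).image ω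

/-- `E^0[cap(X[0,T])]`. -/
def capExpect {d : ℕ} (P : Zd d → Measure (ℕ → Zd d)) (T : ℕ) : ℝ :=
  ∫ ω, capacity P (walkRange ω 0 T) ∂ (P 0)

/-- `1 + log x · 1_{d = 4}`. -/
def logFour (d : ℕ) (x : ℝ) : ℝ := 1 + if d = 4 then Real.log x else 0

/-- `ε` is the constant `ε_d = lim_{T→∞} E^0[cap(X[0,T])]·T^{-1}·(1 + log T·1_{d=4})`,
which lies in `(0,∞)`. -/
def IsCapLimit (d : ℕ) (P : Zd d → Measure (ℕ → Zd d)) (ε : ℝ) : Prop :=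
  0 < ε ∧ Tendsto (fun T : ℕ => capExpect P T * logFour d T / (T : ℝ)) atTop (𝓝 ε)

/-! ### Distributions on `ℕ` -/

/-- `ρ` is a probability distribution on `ℕ`. -/
def IsDist (ρ : ℕ → ℝ) : Prop := (∀ k, 0 ≤ ρ k) ∧ HasSum ρ 1

/-- `k`-th moment `μ_k(ρ)`. -/
def mu (k : ℕ) (ρ : ℕ → ℝ) : ℝ := ∑' l : ℕ, (l : ℝ) ^ k * ρ l

/-- Tail `μ_k^{(m)}(ρ) = Σ_{l ≥ m} l^k ρ(l)`. -/
def muTail (k m : ℕ) (ρ : ℕ → ℝ) : ℝ := ∑' l : ℕ, if m ≤ l then (l : ℝ) ^ k * ρ l else 0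

/-- An appropriate family of distributions on `ℕ`. -/
def Appropriate (ρ : ℕ → ℕ → ℝ) : Prop :=
  (∀ n, IsDist (ρ n)) ∧
  (∀ n, Summable fun l : ℕ => (l : ℝ) ^ 2 * ρ n l) ∧
  Tendsto (fun n => mu 1 (ρ n)) atTop atTop ∧
  ∀ ε : ℝ, 0 < ε → ∃ C : ℝ,
    ∀ n, (∑' L : ℕ, if C * mu 1 (ρ n) ≤ (L : ℝ) then (L : ℝ) ^ 2 * ρ n L / mu 2 (ρ n) else 0) ≤ ε

/-- Geometric distribution `Geo(λ)(k) = λ (1-λ)^k`. -/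
def geo (lam : ℝ) (k : ℕ) : ℝ := lam * (1 - lam) ^ k

/-! ### Trajectories and finitary random interlacements -/

/-- A finite trajectory in `ℤ^d`, recorded as the list of its positions. -/
abbrev Traj (d : ℕ) := List (Zd d)

/-- A point configuration: the multiplicity of each trajectory. -/
abbrev Config (d : ℕ) := Traj d → ℕ

/-- A valid trajectory: a nonempty nearest-neighbour path. -/
def ValidTraj {d : ℕ} (η : Traj d) : Prop := η ≠ [] ∧ η.Chain' IsNN

/-- The time length `T(η)` of a trajectory. -/
def len {d : ℕ} (η : Traj d) : ℕ := η.length - 1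

/-- The range of a trajectory, as a set. -/
def rangeSet {d : ℕ} (η : Traj d) : Set (Zd d) := {y | y ∈ η}

/-- The trajectory `η` visits the set `A`. -/
def hits {d : ℕ} (η : Traj d) (A : Set (Zd d)) : Prop := ∃ y ∈ η, y ∈ A

/-- Poisson probability mass `e^{-r} r^n / n!`. -/
def poissonProb (r : ℝ) (n : ℕ) : ℝ≥0∞ :=
  ENNReal.ofReal (Real.exp (-r) * r ^ n / n.factorial)

/-- The intensity `u·π({η})` that FRI with parameters `(u,ρ)` puts on a single
trajectory `η`: trajectories of length `l` from each starting point carry mass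
`u·ρ(l)/(μ₁(ρ)+1)·(2d)^{-l}` each. -/
def friIntensity (d : ℕ) (u : ℝ) (ρ : ℕ → ℝ) (η : Traj d) : ℝ :=
  if ValidTraj η then u * ρ (len η) / (mu 1 ρ + 1) * (1 / (2 * (d : ℝ))) ^ (len η) else 0

/-- `P` is the law of a Poisson point process on the countable set of trajectories
with intensity function `ι`: the multiplicities of distinct trajectories are
independent Poisson random variables. -/
def IsPoissonPP (d : ℕ) (ι : Traj d → ℝ) (P : Measure (Config d)) : Prop :=
  IsProbabilityMeasure P ∧
    ∀ (F : Finset (Traj d)) (k : Traj d → ℕ),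
      P {ω | ∀ η ∈ F, ω η = k η} = ∏ η ∈ F, poissonProb (ι η) (k η)

/-- `P` is the law of the finitary random interlacements point process `𝒳^{u,ρ}`. -/
def IsFRI (d : ℕ) (u : ℝ) (ρ : ℕ → ℝ) (P : Measure (Config d)) : Prop :=
  IsPoissonPP d (friIntensity d u ρ) P

/-- `J` is the law of an i.i.d. sequence of copies of `𝒳^{u,ρ}`. -/
def IsFRIseq (d : ℕ) (u : ℝ) (ρ : ℕ → ℝ) (J : Measure (ℕ → Config d)) : Prop :=
  IsProbabilityMeasure J ∧
    ∀ (F : Finset (ℕ × Traj d)) (k : ℕ × Traj d → ℕ),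
      J {j | ∀ p ∈ F, j p.1 p.2 = k p} = ∏ p ∈ F, poissonProb (friIntensity d u ρ p.2) (k p)

/-! ### Percolation -/

/-- The edge `{x,y}` is traversed by some trajectory of the configuration `ω`. -/
def EdgeOpen {d : ℕ} (ω : Config d) (x y : Zd d) : Prop :=
  ∃ η : Traj d, 0 < ω η ∧ ∃ i : ℕ,
    (η[i]? = some x ∧ η[i + 1]? = some y) ∨ (η[i]? = some y ∧ η[i + 1]? = some x)

/-- The cluster of `x` in the subgraph `ℐ` induced by the configuration `ω`. -/
def Cluster {d : ℕ} (ω : Config d) (x : Zd d) : Set (Zd d) :=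
  {y | Relation.ReflTransGen (EdgeOpen ω) x y}

/-- The origin lies in an infinite cluster. -/
def PercEvent (d : ℕ) : Set (Config d) := {ω | (Cluster ω 0).Infinite}

/-- The critical intensity `u_*(ρ)`, given the family `u ↦ 𝒳^{u,ρ}`. -/
def uStar (d : ℕ) (X : ℝ → Measure (Config d)) : ℝ :=
  sInf {u : ℝ | 0 ≤ u ∧ 0 < X u (PercEvent d)}

/-- The order `u_n = μ₁(ρ)·(1 + log μ₁(ρ)·1_{d=4}) / (ε_d·μ₂(ρ))` of the
critical intensity. -/
def uN (d : ℕ) (εd : ℝ) (ρ : ℕ → ℝ) : ℝ :=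
  mu 1 ρ * logFour d (mu 1 ρ) / (εd * mu 2 ρ)

/-! ### `ρ`-capacity, Green function, `κ` and `φ` -/

/-- `e_A^{(ρ)}(x) = Σ_m (μ₀^{(m)}(ρ)/(μ₁(ρ)+1))·P^x[H̃_A > m]`. -/
def equilRho {d : ℕ} (P : Zd d → Measure (ℕ → Zd d)) (ρ : ℕ → ℝ) (A : Set (Zd d))
    (x : Zd d) : ℝ :=
  ∑' m : ℕ, (muTail 0 m ρ / (mu 1 ρ + 1)) * (P x (NoReturnUpTo A (m : ℝ))).toReal

/-- `cap^{(ρ)}(A) = Σ_{x∈A} e_A^{(ρ)}(x)`. -/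
def capRho {d : ℕ} (P : Zd d → Measure (ℕ → Zd d)) (ρ : ℕ → ℝ) (A : Finset (Zd d)) : ℝ :=
  ∑ x ∈ A, equilRho P ρ (↑A) x

/-- Green's function `g(x,y) = Σ_t P^x[X_t = y]`. -/
def green {d : ℕ} (P : Zd d → Measure (ℕ → Zd d)) (x y : Zd d) : ℝ :=
  ∑' t : ℕ, (P x {ω | ω t = y}).toReal

/-- `φ^{(ρ)}(A,B) = Σ_{x∈A} Σ_{y∈B} e_A^{(ρ)}(x) e_B^{(ρ)}(y) g(x,y)`. -/
def phiRho {d : ℕ} (P : Zd d → Measure (ℕ → Zd d)) (ρ : ℕ → ℝ) (A B : Finset (Zd d)) : ℝ :=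
  ∑ x ∈ A, ∑ y ∈ B, equilRho P ρ (↑A) x * equilRho P ρ (↑B) y * green P x y

/-- `κ^{(ρ)}(A) = Σ_{x∈A} Σ_m (μ₁^{(m)}(ρ)/μ₂(ρ))·P^x[H̃_A > m]` (real-valued,
for finite `A`). -/
def kappa {d : ℕ} (P : Zd d → Measure (ℕ → Zd d)) (ρ : ℕ → ℝ) (A : Finset (Zd d)) : ℝ :=
  ∑ x ∈ A, ∑' m : ℕ, (muTail 1 m ρ / mu 2 ρ) * (P x (NoReturnUpTo (↑A) (m : ℝ))).toReal

/-- `κ^{(ρ)}(A)` as an extended-real valued quantity, for arbitrary `A`. -/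
def kappaE {d : ℕ} (P : Zd d → Measure (ℕ → Zd d)) (ρ : ℕ → ℝ) (A : Set (Zd d)) : ℝ≥0∞ :=
  ∑' x : Zd d,
    A.indicator (fun x => ∑' m : ℕ,
      ENNReal.ofReal (muTail 1 m ρ / mu 2 ρ) * P x (NoReturnUpTo A (m : ℝ))) x

/-! ### Exploration processes -/

/-- First components: the `k`-th layer `L_k` of vertices; second components:
`∪_{i<k} L_i`.  Layer `L_{k+1}` is spanned by the trajectories of `ω` meeting `L_k`
but not `∪_{i<k} L_i`. -/
def exploreSets {d : ℕ} (ω : Config d) : ℕ → Set (Zd d) × Set (Zd d)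
  | 0 => ({0}, ∅)
  | k + 1 =>
    ({y | ∃ η : Traj d, 0 < ω η ∧ hits η (exploreSets ω k).1 ∧
        ¬ hits η (exploreSets ω k).2 ∧ y ∈ η},
      (exploreSets ω k).1 ∪ (exploreSets ω k).2)

/-- The `i`-th layer `𝓛_i` of trajectories of the exploration of the cluster of the
origin, as a sub-configuration of `ω`. -/
def exploreLayer {d : ℕ} (ω : Config d) : ℕ → Config d
  | 0 => fun _ => 0
  | k + 1 => fun η =>
      if hits η (exploreSets ω k).1 ∧ ¬ hits η (exploreSets ω k).2 then ω η else 0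

/-- The vertex sets `L'_k` of the dominating exploration driven by the i.i.d.
sequence `j`. -/
def exploreSets' {d : ℕ} (j : ℕ → Config d) : ℕ → Set (Zd d)
  | 0 => {0}
  | k + 1 => {y | ∃ η : Traj d, 0 < j (k + 1) η ∧ hits η (exploreSets' j k) ∧ y ∈ η}

/-- The trajectory layers `𝓛'_i` of the dominating exploration. -/
def exploreLayer' {d : ℕ} (j : ℕ → Config d) : ℕ → Config d
  | 0 => fun _ => 0
  | k + 1 => fun η => if hits η (exploreSets' j k) then j (k + 1) η else 0

/-- `W_k = 𝔼[κ^{(ρ)}(L'_k)]`. -/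
def Wexp {d : ℕ} (P : Zd d → Measure (ℕ → Zd d)) (ρ : ℕ → ℝ)
    (J : Measure (ℕ → Config d)) (k : ℕ) : ℝ≥0∞ :=
  ∫⁻ j, kappaE P ρ (exploreSets' j k) ∂ J

/-- `V_k = 𝔼[|L'_k|]`, multiplied by `(log μ₁(ρ))⁻¹` when `d = 4`. -/
def Vexp (d : ℕ) (ρ : ℕ → ℝ) (J : Measure (ℕ → Config d)) (k : ℕ) : ℝ≥0∞ :=
  (if d = 4 then ENNReal.ofReal (1 / Real.log (mu 1 ρ)) else 1) *
    ∫⁻ j, ENat.toENNReal (exploreSets' j k).encard ∂ J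

/-! ### Two-sided finite random walk trajectories -/

/-- `μ(x,m,l)({η})`: the two-sided path `(X_{-m},…,X_l)` of a doubly infinite walk
with `X_0 = x` equals the list `η` (of length `m+l+1`, with `η[m] = x`)
with probability `(2d)^{-(m+l)}` for every admissible nearest-neighbour list. -/
def twoSidedProb (d : ℕ) (x : Zd d) (m l : ℕ) (η : Traj d) : ℝ :=
  if η.length = m + l + 1 ∧ η.Chain' IsNN ∧ η[m]? = some x then
    (1 / (2 * (d : ℝ))) ^ (m + l) else 0

/-- The `ℓ^∞`-diameter of the range of `η` is at most `R`. -/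
def DiamLE {d : ℕ} (η : Traj d) (R : ℝ) : Prop :=
  ∀ a ∈ η, ∀ b ∈ η, ∀ i, |((a i - b i : ℤ) : ℝ)| ≤ R

/-- `P^x[X[-m,-1] ∩ A = ∅]`: the probability that an `m`-step walk from `x`
avoids `A` at all positive times, written combinatorially. -/
def backAvoidProb (d : ℕ) (A : Set (Zd d)) (x : Zd d) (m : ℕ) : ℝ :=
  ∑' w : Traj d,
    if w.length = m + 1 ∧ w.Chain' IsNN ∧ w[0]? = some x ∧
        (∀ i : ℕ, 0 < i → ∀ y, w[i]? = some y → y ∉ A) then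
      (1 / (2 * (d : ℝ))) ^ m else 0

/-- `μ(x,m,l;A)({η}) = P^x[X[-m,l] = η | X[-m,-1] ∩ A = ∅]`. -/
def condTwoSidedProb (d : ℕ) (A : Set (Zd d)) (x : Zd d) (m l : ℕ) (η : Traj d) : ℝ :=
  (if ∀ i < m, ∀ y, η[i]? = some y → y ∉ A then twoSidedProb d x m l η else 0) /
    backAvoidProb d A x m

/-- `π_A({η}) = Σ_{x∈A} Σ_{m,l} (ρ(m+l)/(μ₁(ρ)+1))·P^x[H̃_A > m]·μ(x,m,l;A)({η})`. -/
def piA (d : ℕ) (P : Zd d → Measure (ℕ → Zd d)) (ρ : ℕ → ℝ) (A : Finset (Zd d))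
    (η : Traj d) : ℝ :=
  ∑ x ∈ A, ∑' m : ℕ, ∑' l : ℕ,
    ρ (m + l) / (mu 1 ρ + 1) * (P x (NoReturnUpTo (↑A) (m : ℝ))).toReal *
      condTwoSidedProb d (↑A) x m l η

/-- The sub-configuration of trajectories meeting `A`, i.e. `𝒳[A]`. -/
def restrictConfig {d : ℕ} (A : Finset (Zd d)) (ω : Config d) : Config d :=
  fun η => if hits η (↑A) then ω η else 0

/-! ### Products and geometric laws -/

/-- The geometric measure `Geo(1/(T+1))` on `ℕ`. -/
def geoMeasure (T : ℕ) : Measure ℕ :=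
  Measure.sum fun k : ℕ => (ENNReal.ofReal (geo (1 / ((T : ℝ) + 1)) k)) • Measure.dirac k

/-- `Q` is the product (independent coupling) of `μ` and `ν`. -/
def IsProdOf {α β : Type*} [MeasurableSpace α] [MeasurableSpace β]
    (Q : Measure (α × β)) (μ : Measure α) (ν : Measure β) : Prop :=
  IsProbabilityMeasure Q ∧
    ∀ (A : Set α) (B : Set β), MeasurableSet A → MeasurableSet B → Q (A ×ˢ B) = μ A * ν B

/-! ### Coarse graining quantities -/

/-- The constant `c = 0.01`. -/
def cConst : ℝ := 0.01

/-- `R_n = ⌊√(μ₁(ρ_n))⌋`. -/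
def Rn (ρ : ℕ → ℕ → ℝ) (n : ℕ) : ℕ := ⌊Real.sqrt (mu 1 (ρ n))⌋₊

/-- The mesoscopic scale `L_n`. -/
def Ln (d : ℕ) (ρ : ℕ → ℕ → ℝ) (n : ℕ) : ℝ :=
  if d = 4 then (Rn ρ n : ℝ) * (Real.log (Rn ρ n)) ^ (-cConst)
  else (Rn ρ n : ℝ) ^ ((2 + cConst) / ((d : ℝ) - 2))

/-- The slowly growing factor `I_n`. -/
def In (d : ℕ) (ρ : ℕ → ℕ → ℝ) (n : ℕ) : ℝ :=
  if d = 4 then (Real.log (Rn ρ n)) ^ cConst else (Rn ρ n : ℝ) ^ cConst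

/-- The scale `T'_n`. -/
def Tn' (d : ℕ) (ρ : ℕ → ℕ → ℝ) (n : ℕ) : ℕ :=
  if d = 4 then ⌊(Rn ρ n : ℝ) ^ (2 : ℕ) / Real.log (mu 1 (ρ n))⌋₊
  else ⌊(Rn ρ n : ℝ) ^ ((2 : ℝ) - cConst / 4)⌋₊

/-- The scale `l_n`. -/
def lnPar (d : ℕ) (ρ : ℕ → ℕ → ℝ) (n : ℕ) : ℕ :=
  if d = 4 then ⌊(Rn ρ n : ℝ) * (Real.log (Rn ρ n)) ^ (-(2 * cConst))⌋₊
  else ⌊(Rn ρ n : ℝ) ^ ((1 : ℝ) - cConst / 4)⌋₊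

/-- The scale `t_n`. -/
def tnPar (d : ℕ) (ρ : ℕ → ℕ → ℝ) (n : ℕ) : ℕ :=
  if d = 4 then ⌊(Rn ρ n : ℝ) ^ (2 : ℕ) / (Real.log (Rn ρ n)) ^ (10 : ℕ)⌋₊
  else ⌊(Rn ρ n : ℝ) ^ ((2 : ℝ) - cConst)⌋₊

/-- `y` is within `ℓ^∞`-distance `r` of `z`. -/
def InBall {d : ℕ} (y z : Zd d) (r : ℝ) : Prop := ∀ i, |((y i - z i : ℤ) : ℝ)| ≤ r

/-- The `ℓ^∞` `r`-neighbourhood `B(A,r)`. -/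
def nbhd {d : ℕ} (A : Set (Zd d)) (r : ℝ) : Set (Zd d) := {y | ∃ z ∈ A, InBall y z r}

/-- The sub-path `η[a, b]` of a trajectory. -/
def segment {d : ℕ} (η : Traj d) (a b : ℕ) : Traj d := (η.drop a).take (b - a + 1)

/-- `η` is a typical trajectory (the event `𝒯_n = ℰ₁ ∩ ℰ₂ ∩ ℰ₃ ∩ ℰ₄`). -/
def Typical (d : ℕ) (P : Zd d → Measure (ℕ → Zd d)) (εd : ℝ) (ρ : ℕ → ℕ → ℝ)
    (kk KK M θ1 : ℝ) (n : ℕ) (η : Traj d) : Prop :=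
  ValidTraj η ∧
  -- ℰ₁
  (kk * (Rn ρ n : ℝ) ^ 2 ≤ (len η : ℝ) ∧ (len η : ℝ) ≤ KK * (Rn ρ n : ℝ) ^ 2 ∧
    ∀ y ∈ η, InBall y η.headI (M * (Rn ρ n : ℝ))) ∧
  -- ℰ₂
  (if d = 4 then
    (1 - θ1 ^ 2) * (Real.pi ^ 2 / 8) * (len η : ℝ) / Real.log (mu 1 (ρ n)) <
        capacity P η.toFinset ∧
      capTrunc P η.toFinset ((Rn ρ n : ℝ) ^ 2) <
        (1 + θ1 ^ 2) * (Real.pi ^ 2 / 8) * (len η : ℝ) / Real.log (mu 1 (ρ n))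
  else
    (1 - θ1 ^ 2) * εd * (len η : ℝ) < capacity P η.toFinset ∧
      capacity P η.toFinset < (1 + θ1 ^ 2) * εd * (len η : ℝ)) ∧
  -- ℰ₃
  ((Set.ncard (nbhd (rangeSet η) (Ln d ρ n)) : ℝ) <
    (Rn ρ n : ℝ) ^ 2 * (Ln d ρ n) ^ (d - 2) * (In d ρ n) ^ ((1 : ℝ) / 3)) ∧
  -- ℰ₄
  (∀ j : ℕ, j * Tn' d ρ n ≤ len η →
    if d = 4 then
      capacity P (segment η (j * Tn' d ρ n) (min ((j + 1) * Tn' d ρ n) (len η))).toFinset ≤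
          (1 + θ1 ^ 2) * (Real.pi ^ 2 / 8) * (Tn' d ρ n : ℝ) / Real.log (mu 1 (ρ n)) ∧
        ∀ a ∈ segment η (j * Tn' d ρ n) (min ((j + 1) * Tn' d ρ n) (len η)),
          ∀ b ∈ segment η (j * Tn' d ρ n) (min ((j + 1) * Tn' d ρ n) (len η)),
            ∀ i, |((a i - b i : ℤ) : ℝ)| <
              (1 / 2) * Real.sqrt (len η : ℝ) * (Real.log (mu 1 (ρ n))) ^ (-cConst)
    else
      capacity P (segment η (j * Tn' d ρ n) (min ((j + 1) * Tn' d ρ n) (len η))).toFinset ≤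
        (1 + θ1 ^ 2) * εd * (Tn' d ρ n : ℝ))

/-- `x` belongs to the `*`-proper part `η̂` of the trajectory `η`. -/
def ProperStar (d : ℕ) (P : Zd d → Measure (ℕ → Zd d)) (ρ : ℕ → ℕ → ℝ)
    (θ1 θ2 : ℝ) (n : ℕ) (η : Traj d) (x : Zd d) : Prop :=
  x ∈ rangeSet η ∧
    (if d = 4 then
      θ2 / Real.log (mu 1 (ρ n)) ≤ equil P (rangeSet η) x ∧
        (P x (NoReturnUpTo (rangeSet η)
            ((Rn ρ n : ℝ) ^ 2 / (Real.log (Rn ρ n)) ^ (10 : ℕ)))).toReal ≤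
          (1 + θ1) * equil P (rangeSet η) x
    else θ2 ≤ equil P (rangeSet η) x)

/-- Steps of the walk. -/
abbrev Step (d : ℕ) := Fin d × Bool

/-- The lattice vector of a step. -/
def sv {d : ℕ} (s : Step d) : Zd d := Pi.single s.1 (if s.2 then 1 else -1)

/-- Real averaging operator. -/
def PopR {d : ℕ} (f : Zd d → ℝ) (z : Zd d) : ℝ := (2 * (d : ℝ))⁻¹ * ∑ s : Step d, f (z + sv s)

/-- Real heat kernel. -/
def pR {d : ℕ} : ℕ → Zd d → ℝ
  | 0 => fun z => if z = 0 then 1 else 0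
  | t + 1 => PopR (pR t)

/-- Uniform measure on the torus box. -/
def boxM (d : ℕ) : Measure (Fin d → ℝ) :=
  Measure.pi fun _ => (volume.restrict (Set.Ioc (-Real.pi) Real.pi))

instance (d : ℕ) : IsFiniteMeasure (boxM d) := by
  unfold boxM; infer_instance

/-- Characteristic function of a step. -/
def chf {d : ℕ} (θ : Fin d → ℝ) : ℝ := (d : ℝ)⁻¹ * ∑ i, Real.cos (θ i)

def dotp {d : ℕ} (θ : Fin d → ℝ) (x : Zd d) : ℝ := ∑ i, θ i * (x i : ℝ)

lemma continuous_chf {d : ℕ} : Continuous (chf (d := d)) := by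
  unfold chf; fun_prop

lemma continuous_dotp {d : ℕ} (x : Zd d) : Continuous (fun θ => dotp (d := d) θ x) := by
  unfold dotp; fun_prop

lemma abs_chf_le {d : ℕ} (θ : Fin d → ℝ) :
    |chf θ| ≤ Real.exp (-(1 / (2 * (d : ℝ))) * ∑ i, Real.sin (θ i) ^ 2) := by
  rcases Nat.eq_zero_or_pos d with h | h
  · subst h; simp [chf]
  have hd : (0 : ℝ) < d := by exact_mod_cast h
  have h1 : |chf θ| ≤ (d : ℝ)⁻¹ * ∑ i, (1 - Real.sin (θ i) ^ 2 / 2) := by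
    unfold chf
    rw [abs_mul, abs_of_pos (inv_pos.2 hd)]
    gcongr
    refine (Finset.abs_sum_le_sum_abs _ _).trans (Finset.sum_le_sum fun i _ => ?_)
    have := Real.sin_sq_add_cos_sq (θ i)
    rw [abs_le]
    constructor <;> nlinarith [sq_nonneg (Real.cos (θ i) - 1), sq_nonneg (Real.cos (θ i) + 1)]
  refine h1.trans ?_
  have h2 : (d : ℝ)⁻¹ * ∑ i : Fin d, (1 - Real.sin (θ i) ^ 2 / 2)
      = -(1 / (2 * (d : ℝ))) * ∑ i, Real.sin (θ i) ^ 2 + 1 := by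
    rw [Finset.sum_sub_distrib, ← Finset.sum_div]
    simp
    field_simp
    ring
  rw [h2]
  exact Real.add_one_le_exp _

lemma abs_chf_le_one {d : ℕ} (θ : Fin d → ℝ) : |chf θ| ≤ 1 := by
  refine (abs_chf_le θ).trans ?_
  rw [Real.exp_le_one_iff, neg_mul, neg_nonpos]
  have : 0 ≤ ∑ i, Real.sin (θ i) ^ 2 := Finset.sum_nonneg fun i _ => sq_nonneg _
  positivity

lemma integrable_of_cont_bdd {d : ℕ} {f : (Fin d → ℝ) → ℝ} (hf : Continuous f) (C : ℝ)
    (hC : ∀ θ, |f θ| ≤ C) : Integrable f (boxM d) :=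
  Integrable.of_bound hf.aestronglyMeasurable C (Eventually.of_forall hC)

lemma integrable_four {d : ℕ} (t : ℕ) (x : Zd d) :
    Integrable (fun θ => chf θ ^ t * Real.cos (dotp θ x)) (boxM d) := by
  refine integrable_of_cont_bdd ((continuous_chf.pow t).mul
    (Real.continuous_cos.comp (continuous_dotp x))) 1 fun θ => ?_
  rw [abs_mul, abs_pow]
  exact mul_le_one₀ (pow_le_one₀ (abs_nonneg _) (abs_chf_le_one θ)) (abs_nonneg _)
    (Real.abs_cos_le_one _)

lemma four_zero {d : ℕ} (x : Zd d) :
    ∫ θ, Real.cos (dotp θ x) ∂(boxM d) = if x = 0 then (2 * Real.pi) ^ d else 0 := by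
  have h1 : ∀ θ : Fin d → ℝ, ((Real.cos (dotp θ x) : ℝ))
      = RCLike.re (∏ i, Complex.exp (((x i : ℝ) * Complex.I) * (θ i : ℂ))) := by
    intro θ
    rw [← Complex.exp_sum]
    have : ∑ i, ((x i : ℝ) * Complex.I) * (θ i : ℂ) = ((dotp θ x : ℝ) : ℂ) * Complex.I := by
      unfold dotp
      push_cast
      rw [Finset.sum_mul]
      exact Finset.sum_congr rfl fun i _ => by ring
    rw [this]
    simp [Complex.exp_ofReal_mul_I_re]
  simp_rw [h1]
  have hIntg : Integrable (fun θ : Fin d → ℝ => ∏ i, Complex.exp (((x i : ℝ) * Complex.I) * (θ i : ℂ)))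
      (boxM d) := by
    refine Integrable.of_bound (Continuous.aestronglyMeasurable (by fun_prop)) 1
      (Eventually.of_forall fun θ => ?_)
    rw [norm_prod]
    refine Finset.prod_le_one (fun _ _ => norm_nonneg _) fun i _ => ?_
    rw [Complex.norm_exp]; simp
  rw [integral_re hIntg]
  unfold boxM
  rw [integral_fintype_prod_eq_prod (f := fun i (θ : ℝ) => Complex.exp (((x i : ℝ) * Complex.I) * (θ : ℂ)))]
  have h2 : ∀ k : ℤ, ∫ θ in Set.Ioc (-Real.pi) Real.pi, Complex.exp (((k : ℝ) * Complex.I) * (θ : ℂ))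
      = if k = 0 then ((2 * Real.pi : ℝ) : ℂ) else 0 := by
    intro k
    rw [← intervalIntegral.integral_of_le (by linarith [Real.pi_pos])]
    split_ifs with hk
    · subst hk
      simp
      ring
    · rw [integral_exp_mul_complex (by simp [hk, Complex.I_ne_zero])]
      have : Complex.exp (((k : ℝ) * Complex.I) * ((Real.pi : ℝ) : ℂ))
          = Complex.exp (((k : ℝ) * Complex.I) * ((-Real.pi : ℝ) : ℂ)) := by
        rw [Complex.exp_eq_exp_iff_exists_int]
        exact ⟨k, by push_cast; ring⟩
      rw [this]; simp
  simp_rw [h2]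
  split_ifs with hx
  · subst hx; simp [← Complex.ofReal_ofNat, ← Complex.ofReal_mul, ← Complex.ofReal_pow]
  · obtain ⟨i, hi⟩ : ∃ i, x i ≠ 0 := by
      by_contra! h; exact hx (funext h)
    rw [Finset.prod_eq_zero (Finset.mem_univ i) (by simp [hi])]; simp

lemma dotp_add {d : ℕ} (θ : Fin d → ℝ) (x y : Zd d) : dotp θ (x + y) = dotp θ x + dotp θ y := by
  simp [dotp, mul_add, Finset.sum_add_distrib]

lemma dotp_sv {d : ℕ} (θ : Fin d → ℝ) (s : Step d) :
    dotp θ (sv s) = if s.2 then θ s.1 else - θ s.1 := by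
  unfold dotp sv
  rw [Finset.sum_eq_single s.1]
  · split_ifs <;> simp
  · intro b _ hb; simp [Pi.single_apply, hb]
  · simp

lemma pR_four {d : ℕ} (t : ℕ) (x : Zd d) :
    pR t x = ((2 * Real.pi) ^ d)⁻¹ * ∫ θ, chf θ ^ t * Real.cos (dotp θ x) ∂(boxM d) := by
  induction t generalizing x with
  | zero =>
    simp only [pow_zero, one_mul, four_zero, pR]
    have := Real.pi_pos
    split_ifs
    · field_simp
    · simp
  | succ t ih =>
    simp only [pR, PopR, ih]
    rw [← Finset.mul_sum, mul_left_comm, ← integral_finsetSum _ (fun s _ => integrable_four t _),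
      ← integral_const_mul]
    congr 2
    ext θ
    simp only [dotp_add, dotp_sv, Fintype.sum_prod_type, Fintype.sum_bool, Real.cos_add]
    simp only [if_true, Bool.false_eq_true, if_false, Real.cos_neg, Real.sin_neg]
    rw [pow_succ]
    unfold chf
    rw [Finset.mul_sum, Finset.mul_sum, Finset.mul_sum, Finset.sum_mul]
    refine Finset.sum_congr rfl fun i _ => ?_
    have : (d : ℝ) ≠ 0 := by
      have := i.pos; positivity
    field_simp
    ring

lemma pR_even_le {d : ℕ} (t : ℕ) (x : Zd d) : pR (2 * t) x ≤ pR (2 * t) (0 : Zd d) := by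
  rw [pR_four, pR_four]
  have := Real.pi_pos
  gcongr
  · exact integrable_four _ _
  · exact integrable_four _ _
  · intro θ
    simp [dotp]
    rw [pow_mul]
    exact mul_le_of_le_one_right (by positivity) (Real.cos_le_one _)

lemma pR_even_anti {d : ℕ} {s t : ℕ} (h : s ≤ t) : pR (2 * t) (0 : Zd d) ≤ pR (2 * s) (0 : Zd d) := by
  rw [pR_four, pR_four]
  have := Real.pi_pos
  gcongr
  · exact integrable_four _ _
  · exact integrable_four _ _
  · intro θ
    simp [dotp]
    rw [pow_mul, pow_mul]
    refine pow_le_pow_of_le_one (by positivity) ?_ h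
    have := abs_chf_le_one θ
    rw [← sq_abs]
    exact pow_le_one₀ (abs_nonneg _) this

lemma J_bound (β : ℝ) (hβ : 0 < β) :
    ∫ θ in Set.Ioc (-Real.pi) Real.pi, Real.exp (-β * Real.sin θ ^ 2)
      ≤ 2 * √(Real.pi / (β * (2 / Real.pi) ^ 2)) := by
  have hpi := Real.pi_pos
  rw [← intervalIntegral.integral_of_le (by linarith)]
  have hc : Continuous fun θ : ℝ => Real.exp (-β * Real.sin θ ^ 2) := by fun_prop
  have hper : Function.Periodic (fun θ : ℝ => Real.exp (-β * Real.sin θ ^ 2)) Real.pi := by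
    intro θ; simp [Real.sin_add_pi]
  rw [← intervalIntegral.integral_add_adjacent_intervals (b := 0)
    (hc.intervalIntegrable _ _) (hc.intervalIntegrable _ _)]
  have e1 := hper.intervalIntegral_add_eq (-Real.pi) (-(Real.pi / 2))
  have e2 := hper.intervalIntegral_add_eq 0 (-(Real.pi / 2))
  rw [neg_add_cancel] at e1
  rw [zero_add] at e2
  rw [e1, e2]
  have hb : 0 < β * (2 / Real.pi) ^ 2 := by positivity
  have key : ∫ θ in (-(Real.pi / 2))..(-(Real.pi / 2) + Real.pi), Real.exp (-β * Real.sin θ ^ 2)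
      ≤ √(Real.pi / (β * (2 / Real.pi) ^ 2)) := by
    rw [← integral_gaussian, intervalIntegral.integral_of_le (by linarith)]
    have hg := integrable_exp_neg_mul_sq hb
    refine le_trans (setIntegral_mono_on ?_ hg.integrableOn measurableSet_Ioc ?_)
      (setIntegral_le_integral hg (Eventually.of_forall fun θ => (Real.exp_pos _).le))
    · exact (hc.integrableOn_Icc (a := -(Real.pi / 2)) (b := -(Real.pi / 2) + Real.pi)).mono_set
        Set.Ioc_subset_Icc_self
    · intro θ hθ
      have habs : |θ| ≤ Real.pi / 2 := by
        rw [abs_le]; constructor <;> linarith [hθ.1, hθ.2]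
      have h1 := Real.mul_abs_le_abs_sin habs
      have h2 : (2 / Real.pi * |θ|) ^ 2 ≤ Real.sin θ ^ 2 := by
        rw [← sq_abs (Real.sin θ)]
        gcongr
      rw [mul_pow, sq_abs] at h2
      apply Real.exp_le_exp.2
      nlinarith
  linarith

lemma pR_upper (d : ℕ) (hd : 0 < d) : ∃ C : ℝ, 0 < C ∧ ∀ (t : ℕ) (x : Zd d),
    pR t x ≤ C / √((t : ℝ) + 1) ^ d := by
  have hpi := Real.pi_pos
  have hd' : (1 : ℝ) ≤ d := by exact_mod_cast hd
  set K : ℝ := Real.exp 1 * (2 * √(Real.pi / ((1 / (2 * (d : ℝ))) * (2 / Real.pi) ^ 2))) with hK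
  have hKpos : 0 < K := by positivity
  refine ⟨((2 * Real.pi) ^ d)⁻¹ * K ^ d, by positivity, fun t x => ?_⟩
  rw [pR_four, mul_div_assoc]
  gcongr
  have h1 : ∀ θ : Fin d → ℝ, chf θ ^ t * Real.cos (dotp θ x)
      ≤ ∏ i, (Real.exp 1 * Real.exp (-((1 / (2 * (d : ℝ))) * ((t : ℝ) + 1)) * Real.sin (θ i) ^ 2)) := by
    intro θ
    have a1 : chf θ ^ t * Real.cos (dotp θ x) ≤ |chf θ| ^ t := by
      refine (le_abs_self _).trans ?_
      rw [abs_mul, abs_pow]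
      exact mul_le_of_le_one_right (by positivity) (Real.abs_cos_le_one _)
    refine a1.trans ((pow_le_pow_left₀ (abs_nonneg _) (abs_chf_le θ) t).trans ?_)
    rw [← Real.exp_nat_mul]
    simp_rw [← Real.exp_add]
    rw [← Real.exp_sum]
    apply Real.exp_le_exp.2
    rw [Finset.mul_sum, Finset.mul_sum]
    refine Finset.sum_le_sum fun i _ => ?_
    have hs : Real.sin (θ i) ^ 2 ≤ 1 := Real.sin_sq_le_one _
    have hdd : 1 / (2 * (d : ℝ)) ≤ 1 := by
      rw [div_le_one (by positivity)]; linarith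
    have h0 : 0 ≤ 1 / (2 * (d : ℝ)) := by positivity
    nlinarith [mul_le_mul hdd hs (sq_nonneg _) zero_le_one]
  refine (integral_mono (integrable_four t x) ?_ h1).trans ?_
  · refine integrable_of_cont_bdd (by fun_prop) (Real.exp 1 ^ d) fun θ => ?_
    rw [abs_of_nonneg (by positivity)]
    calc _ ≤ ∏ i : Fin d, Real.exp 1 := by
          refine Finset.prod_le_prod (fun i _ => by positivity) fun i _ => ?_
          refine mul_le_of_le_one_right (by positivity) ?_
          rw [Real.exp_le_one_iff, neg_mul, neg_nonpos]; positivity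
      _ = _ := by simp
  · unfold boxM
    rw [integral_fintype_prod_eq_prod (f := fun (i : Fin d) (θ : ℝ) =>
      Real.exp 1 * Real.exp (-((1 / (2 * (d : ℝ))) * ((t : ℝ) + 1)) * Real.sin θ ^ 2))]
    rw [← div_pow]
    calc _ ≤ ∏ i : Fin d, K / √((t : ℝ) + 1) := by
          refine Finset.prod_le_prod (fun i _ => integral_nonneg fun θ => by positivity)
            fun i _ => ?_
          rw [integral_const_mul, hK, mul_div_assoc]
          gcongr
          refine (J_bound _ (by positivity)).trans (le_of_eq ?_)
          rw [mul_div_assoc, ← Real.sqrt_div (by positivity)]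
          congr 2
          field_simp
      _ = _ := by rw [Finset.prod_const, Finset.card_univ, Fintype.card_fin]

lemma pR_lower (d : ℕ) (h : 0 < d) : ∃ c : ℝ, 0 < c ∧ ∀ (t : ℕ),
    c / √((t : ℝ) + 1) ^ d ≤ pR (2 * t) (0 : Zd d) := by
  have hpi := Real.pi_pos
  refine ⟨((2 * Real.pi) ^ d)⁻¹ * (1 / 2 * (2 / √2) ^ d), by positivity, fun t => ?_⟩
  rw [pR_four, mul_div_assoc]
  gcongr
  set δ : ℝ := 1 / √(2 * ((t : ℝ) + 1)) with hδ
  have hδ0 : 0 < δ := by positivity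
  have hδsq : δ ^ 2 = 1 / (2 * ((t : ℝ) + 1)) := by
    rw [hδ, div_pow, Real.sq_sqrt (by positivity)]; simp
  have hδ1 : δ ≤ 1 := by
    have : δ ^ 2 ≤ 1 := by
      rw [hδsq, div_le_one (by positivity)]
      have : (0 : ℝ) ≤ t := by positivity
      linarith
    nlinarith
  have hδpi : δ < Real.pi := by linarith [Real.pi_gt_three]
  have hm : MeasurableSet (Set.univ.pi fun _ : Fin d => Set.Ioc (-δ) δ) :=
    MeasurableSet.univ_pi fun _ => measurableSet_Ioc
  have hdpos : (0 : ℝ) < d := by exact_mod_cast h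
  have h1 : ∀ θ ∈ (Set.univ.pi fun _ : Fin d => Set.Ioc (-δ) δ), (1 : ℝ) / 2 ≤ chf θ ^ (2 * t) := by
    intro θ hθ
    have hc : 1 + (-(1 / (4 * ((t : ℝ) + 1)))) ≤ chf θ := by
      unfold chf
      have : ∑ i : Fin d, (1 + (-(1 / (4 * ((t : ℝ) + 1))))) ≤ ∑ i, Real.cos (θ i) := by
        refine Finset.sum_le_sum fun i _ => ?_
        have hi := hθ i trivial
        have := Real.one_sub_sq_div_two_le_cos (x := θ i)
        have h2 : θ i ^ 2 ≤ δ ^ 2 := sq_le_sq' hi.1.le hi.2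
        rw [hδsq] at h2
        have : 1 / (4 * ((t : ℝ) + 1)) = 1 / (2 * ((t : ℝ) + 1)) / 2 := by field_simp; norm_num
        linarith
      simp only [Finset.sum_const, Finset.card_univ, Fintype.card_fin, nsmul_eq_mul] at this
      rw [inv_mul_eq_div, le_div_iff₀ hdpos]
      linarith
    have h4 : 1 / (4 * ((t : ℝ) + 1)) ≤ 1 / 4 := by
      gcongr; have : (0 : ℝ) ≤ t := by positivity
      linarith
    have hb := one_add_mul_le_pow (a := -(1 / (4 * ((t : ℝ) + 1)))) (by linarith) (2 * t)
    refine le_trans ?_ (hb.trans (pow_le_pow_left₀ (by linarith) hc _))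
    have : ((2 * t : ℕ) : ℝ) * (1 / (4 * ((t : ℝ) + 1))) ≤ 1 / 2 := by
      push_cast
      rw [mul_one_div, div_le_iff₀ (by positivity)]
      linarith
    linarith
  have h2 : (boxM d).real (Set.univ.pi fun _ : Fin d => Set.Ioc (-δ) δ) = (2 * δ) ^ d := by
    unfold boxM
    rw [measureReal_def, Measure.pi_pi]
    have : (volume.restrict (Set.Ioc (-Real.pi) Real.pi)) (Set.Ioc (-δ) δ) = ENNReal.ofReal (2 * δ) := by
      rw [Measure.restrict_apply measurableSet_Ioc, Set.inter_eq_left.2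
        (Set.Ioc_subset_Ioc (by linarith) hδpi.le), Real.volume_Ioc]
      congr 1; ring
    simp only [this, Finset.prod_const, Finset.card_univ, Fintype.card_fin]
    rw [ENNReal.toReal_pow, ENNReal.toReal_ofReal (by positivity)]
  calc (1 / 2 * (2 / √2) ^ d) / √((t : ℝ) + 1) ^ d
      = (2 * δ) ^ d * (1 / 2) := by
        rw [hδ, mul_div_assoc, ← div_pow, Real.sqrt_mul (by norm_num)]
        rw [mul_comm]
        congr 2
        field_simp
    _ = ∫ θ in (Set.univ.pi fun _ : Fin d => Set.Ioc (-δ) δ), (1 / 2 : ℝ) ∂(boxM d) := by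
        rw [setIntegral_const, h2, smul_eq_mul]
    _ ≤ ∫ θ in (Set.univ.pi fun _ : Fin d => Set.Ioc (-δ) δ), chf θ ^ (2 * t) * Real.cos (dotp θ (0 : Zd d)) ∂(boxM d) := by
        refine setIntegral_mono_on (integrable_const _).integrableOn (integrable_four _ _).integrableOn hm ?_
        intro θ hθ
        simpa [dotp] using h1 θ hθ
    _ ≤ _ := by
        refine setIntegral_le_integral (integrable_four _ _) (Eventually.of_forall fun θ => ?_)
        simp [dotp]
        rw [pow_mul]; positivity

/-- Averaging operator on nonnegative functions. -/
def Pop {d : ℕ} (f : Zd d → ℝ≥0∞) (z : Zd d) : ℝ≥0∞ :=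
  ((2 * d : ℕ) : ℝ≥0∞)⁻¹ * ∑ s : Step d, f (z + sv s)

/-- Heat kernel, extended nonnegative version. -/
def pE {d : ℕ} : ℕ → Zd d → ℝ≥0∞
  | 0 => fun z => if z = 0 then 1 else 0
  | t + 1 => Pop (pE t)

lemma pR_nonneg {d : ℕ} (t : ℕ) (x : Zd d) : 0 ≤ pR t x := by
  induction t generalizing x with
  | zero => simp only [pR]; split_ifs <;> norm_num
  | succ t ih =>
    simp only [pR, PopR]
    exact mul_nonneg (by positivity) (Finset.sum_nonneg fun s _ => ih _)

lemma pE_eq {d : ℕ} (hd : 0 < d) (t : ℕ) (x : Zd d) : pE t x = ENNReal.ofReal (pR t x) := by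
  induction t generalizing x with
  | zero => simp only [pR, pE]; split_ifs <;> simp
  | succ t ih =>
    simp only [pR, PopR, pE, Pop, ih]
    rw [ENNReal.ofReal_mul (by positivity), ENNReal.ofReal_sum_of_nonneg (fun s _ => pR_nonneg _ _)]
    congr 1
    have : (0 : ℝ) < d := by exact_mod_cast hd
    rw [ENNReal.ofReal_inv_of_pos (by positivity)]
    congr 1
    rw [show (2 * (d : ℝ)) = ((2 * d : ℕ) : ℝ) by push_cast; ring, ENNReal.ofReal_natCast]

lemma Pop_mono {d : ℕ} {f g : Zd d → ℝ≥0∞} (h : ∀ z, f z ≤ g z) (z : Zd d) : Pop f z ≤ Pop g z := by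
  unfold Pop; gcongr; exact h _

lemma Pop_sum {d : ℕ} {ι : Type*} (F : Finset ι) (f : ι → Zd d → ℝ≥0∞) (z : Zd d) :
    Pop (fun y => ∑ i ∈ F, f i y) z = ∑ i ∈ F, Pop (f i) z := by
  unfold Pop
  rw [Finset.sum_comm, Finset.mul_sum]

lemma Pop_mul_const {d : ℕ} (f : Zd d → ℝ≥0∞) (c : ℝ≥0∞) (z : Zd d) :
    Pop (fun y => f y * c) z = Pop f z * c := by
  unfold Pop
  rw [← Finset.sum_mul, mul_assoc]

lemma Pop_shift {d : ℕ} (f : Zd d → ℝ≥0∞) (y z : Zd d) :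
    Pop (fun w => f (w - y)) z = Pop f (z - y) := by
  unfold Pop
  simp only [sub_add_eq_add_sub]

def negStep {d : ℕ} : Step d ≃ Step d where
  toFun s := (s.1, !s.2)
  invFun s := (s.1, !s.2)
  left_inv s := by simp
  right_inv s := by simp

lemma sv_neg {d : ℕ} (s : Step d) : sv (negStep s) = - sv s := by
  unfold sv negStep
  rcases s with ⟨i, b⟩
  cases b <;> simp [← Pi.single_neg]

lemma Pop_adj {d : ℕ} (f g : Zd d → ℝ≥0∞) :
    ∑' z, Pop f z * g z = ∑' z, f z * Pop g z := by
  unfold Pop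
  have h1 : ∀ z, ((2 * d : ℕ) : ℝ≥0∞)⁻¹ * (∑ s : Step d, f (z + sv s)) * g z
      = ((2 * d : ℕ) : ℝ≥0∞)⁻¹ * ∑ s : Step d, f (z + sv s) * g z := by
    intro z; rw [mul_assoc, Finset.sum_mul]
  have h2 : ∀ z, f z * (((2 * d : ℕ) : ℝ≥0∞)⁻¹ * ∑ s : Step d, g (z + sv s))
      = ((2 * d : ℕ) : ℝ≥0∞)⁻¹ * ∑ s : Step d, f z * g (z + sv s) := by
    intro z; rw [mul_left_comm, Finset.mul_sum]
  simp_rw [h1, h2, ENNReal.tsum_mul_left]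
  congr 1
  rw [Summable.tsum_finsetSum (fun _ _ => ENNReal.summable),
    Summable.tsum_finsetSum (fun _ _ => ENNReal.summable)]
  rw [← Equiv.sum_comp negStep]
  refine Finset.sum_congr rfl fun s _ => ?_
  rw [← Equiv.tsum_eq (Equiv.addRight (sv s))]
  simp [sv_neg]

lemma pE_conv {d : ℕ} (a b : ℕ) (x y : Zd d) :
    ∑' z, pE a (z - x) * pE b (z - y) = pE (a + b) (x - y) := by
  induction a generalizing b with
  | zero =>
    rw [tsum_eq_single x]
    · simp [pE]
    · intro z hz; simp [pE, sub_eq_zero, hz]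
  | succ a ih =>
    have h1 : ∀ z, pE (a + 1) (z - x) = Pop (fun w => pE a (w - x)) z := fun z => by
      rw [Pop_shift]; rfl
    simp_rw [h1]
    rw [Pop_adj]
    have h2 : ∀ z, Pop (fun w => pE b (w - y)) z = pE (b + 1) (z - y) := fun z => by
      rw [Pop_shift]; rfl
    simp_rw [h2]
    rw [ih]
    congr 1; omega

/-- `P^z[H_A = m, S_m = x]` (for `x ∈ A`). -/
def bk {d : ℕ} (A : Finset (Zd d)) (x : Zd d) : ℕ → Zd d → ℝ≥0∞
  | 0 => fun z => if z = x then 1 else 0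
  | m + 1 => fun z => if z ∈ A then 0 else Pop (bk A x m) z

/-- `P^z[H_A = m]`. -/
def bt {d : ℕ} (A : Finset (Zd d)) : ℕ → Zd d → ℝ≥0∞
  | 0 => fun z => if z ∈ A then 1 else 0
  | m + 1 => fun z => if z ∈ A then 0 else Pop (bt A m) z

lemma bt_eq {d : ℕ} (A : Finset (Zd d)) (m : ℕ) (z : Zd d) :
    bt A m z = ∑ x ∈ A, bk A x m z := by
  induction m generalizing z with
  | zero => simp [bt, bk]
  | succ m ih =>
    simp only [bt, bk]
    split_ifs with h
    · simp
    · rw [← Pop_sum]; congr 1; ext y; exact ih y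

lemma bk_le {d : ℕ} (A : Finset (Zd d)) (x : Zd d) (m : ℕ) (z : Zd d) :
    bk A x m z ≤ pE m (z - x) := by
  induction m generalizing z with
  | zero => simp [bk, pE, sub_eq_zero]
  | succ m ih =>
    simp only [bk]
    split_ifs with h
    · simp
    · refine (Pop_mono ih z).trans ?_
      rw [Pop_shift]; rfl

lemma first_entrance {d : ℕ} (A : Finset (Zd d)) (y : Zd d) (a : ℕ) (z : Zd d) :
    ∑ m ∈ Finset.range (a + 1), ∑ x ∈ A, bk A x m z * pE (a - m) (x - y) ≤ pE a (z - y) := by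
  by_cases hz : z ∈ A
  · rw [Finset.sum_range_succ']
    have : ∀ m ∈ Finset.range a, ∑ x ∈ A, bk A x (m + 1) z * pE (a - (m + 1)) (x - y) = 0 := by
      intro m _
      refine Finset.sum_eq_zero fun x _ => by simp [bk, hz]
    rw [Finset.sum_eq_zero this]
    simp [bk, hz]
  induction a generalizing z with
  | zero => simp [bk, hz]
  | succ a ih =>
    rw [Finset.sum_range_succ']
    have h0 : ∑ x ∈ A, bk A x 0 z * pE (a + 1 - 0) (x - y) = 0 := by
      refine Finset.sum_eq_zero fun x hx => ?_
      have : z ≠ x := fun h => hz (h ▸ hx)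
      simp [bk, this]
    rw [h0, add_zero]
    have h1 : ∀ m ∈ Finset.range (a + 1), ∑ x ∈ A, bk A x (m + 1) z * pE (a + 1 - (m + 1)) (x - y)
        = Pop (fun w => ∑ x ∈ A, bk A x m w * pE (a - m) (x - y)) z := by
      intro m _
      rw [Pop_sum]
      refine Finset.sum_congr rfl fun x _ => ?_
      rw [Pop_mul_const]
      simp [bk, hz]
    rw [Finset.sum_congr rfl h1, ← Pop_sum]
    have h2 : pE (a + 1) (z - y) = Pop (fun w => pE a (w - y)) z := by rw [Pop_shift]; rfl
    rw [h2]
    refine Pop_mono (fun w => ?_) z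
    by_cases hw : w ∈ A
    · rw [Finset.sum_range_succ']
      have : ∀ m ∈ Finset.range a, ∑ x ∈ A, bk A x (m + 1) w * pE (a - (m + 1)) (x - y) = 0 := by
        intro m _
        refine Finset.sum_eq_zero fun x _ => by simp [bk, hw]
      rw [Finset.sum_eq_zero this]
      simp [bk, hw]
    · exact ih w hw

lemma bt_reverse {d : ℕ} (A : Finset (Zd d)) (m l : ℕ) :
    ∑ x ∈ A, Pop (bt A (m + l)) x = ∑' z, bt A m z * Pop (bt A l) z := by
  induction m generalizing l with
  | zero =>
    rw [zero_add, tsum_eq_sum (s := A)]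
    · refine Finset.sum_congr rfl fun x hx => ?_
      simp [bt, hx]
    · intro z hz
      simp [bt, hz]
  | succ m ih =>
    rw [show m + 1 + l = m + (l + 1) by omega, ih, ]
    have : ∀ z, bt A (m + 1) z * Pop (bt A l) z = Pop (bt A m) z * bt A (l + 1) z := by
      intro z
      simp only [bt]
      split_ifs <;> simp
    simp_rw [this]
    rw [Pop_adj]

lemma bt_reverse' {d : ℕ} (A : Finset (Zd d)) (m l : ℕ) (hm : 1 ≤ m) :
    ∑ x ∈ A, Pop (bt A (m + l)) x = ∑' z, bt A m z * bt A (l + 1) z := by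
  rw [bt_reverse]
  congr 1; ext z
  obtain ⟨m, rfl⟩ : ∃ m', m = m' + 1 := ⟨m - 1, by omega⟩
  simp only [bt]
  split_ifs <;> simp

/-- The capacity difference. -/
def Dn {d : ℕ} (A : Finset (Zd d)) (n : ℕ) : ℝ≥0∞ := ∑ x ∈ A, ∑' l, Pop (bt A (n + l)) x

lemma Dn_le {d : ℕ} (A : Finset (Zd d)) (n m : ℕ) (hm : 1 ≤ m) (hmn : m ≤ n) :
    Dn A n ≤ ∑' z, bt A m z * ∑' l, bt A l z := by
  unfold Dn
  rw [← Summable.tsum_finsetSum (fun _ _ => ENNReal.summable)]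
  have : ∀ l, ∑ x ∈ A, Pop (bt A (n + l)) x = ∑' z, bt A m z * bt A (n - m + l + 1) z := by
    intro l
    rw [← bt_reverse' A m _ hm]
    congr; ext x; congr 2; omega
  simp_rw [this]
  rw [ENNReal.tsum_comm]
  simp_rw [ENNReal.tsum_mul_left]
  refine ENNReal.tsum_le_tsum fun z => mul_le_mul' le_rfl ?_
  refine ENNReal.tsum_comp_le_tsum_of_injective (f := fun l => n - m + l + 1) ?_ (fun l => bt A l z)
  intro a b h; simp at h; omega

lemma Dn_sum_le {d : ℕ} (A : Finset (Zd d)) (n m0 : ℕ) (hm : 1 ≤ m0) :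
    ((n + 1 - m0 : ℕ) : ℝ≥0∞) * Dn A n ≤
      ∑' z, (∑ m ∈ Finset.Icc m0 n, bt A m z) * ∑' l, bt A l z := by
  simp_rw [Finset.sum_mul]
  rw [Summable.tsum_finsetSum (fun _ _ => ENNReal.summable)]
  calc _ = ∑ m ∈ Finset.Icc m0 n, Dn A n := by simp
    _ ≤ _ := Finset.sum_le_sum fun m h => by
      rw [Finset.mem_Icc] at h
      exact Dn_le A n m (by omega) (by omega)

lemma reindex (F : ℕ → ℕ → ℝ≥0∞) (m0 n win : ℕ) :
    ∑ m ∈ Finset.Icc m0 n, ∑ i ∈ Finset.range (win + 1), F m i ≤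
      ∑ a ∈ Finset.Icc m0 (n + win), ∑ m ∈ Finset.range (a + 1), F m (a - m) := by
  rw [Finset.sum_sigma', Finset.sum_sigma']
  have inj : Set.InjOn (fun p : (_ : ℕ) × ℕ => (⟨p.1 + p.2, p.1⟩ : (_ : ℕ) × ℕ))
      ((Finset.Icc m0 n).sigma fun _ => Finset.range (win + 1)) := by
    rintro ⟨a, b⟩ _ ⟨a', b'⟩ _ h
    simp only [Sigma.mk.injEq, heq_eq_eq] at h
    obtain ⟨h1, rfl⟩ := h
    have : b = b' := by omega
    rw [this]
  have := Finset.sum_image (f := fun p : (_ : ℕ) × ℕ => F p.2 (p.1 - p.2)) inj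
  simp only [Nat.add_sub_cancel_left] at this
  rw [← this]
  refine Finset.sum_le_sum_of_subset fun p hp => ?_
  rw [Finset.mem_image] at hp
  obtain ⟨q, hq, rfl⟩ := hp
  simp only [Finset.mem_sigma, Finset.mem_Icc, Finset.mem_range] at hq ⊢
  omega

/-- The set of points visited up to time `T`. -/
def rng {d : ℕ} (X : ℕ → Zd d) (T : ℕ) : Finset (Zd d) := (Finset.range (T + 1)).image X

/-- Weight of a time. -/
def thw (κ : ℝ≥0∞) (bad : ℕ → Prop) (k : ℕ) : ℝ≥0∞ := κ + if bad k then 1 else 0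

lemma hit_bound {d : ℕ} (X : ℕ → Zd d) (T win : ℕ) (κ : ℝ≥0∞) (bad : ℕ → Prop)
    (hgood : ∀ k ≤ T, ¬ bad k → 1 ≤ κ * ∑ j ∈ Finset.range (T + win + 1),
      ∑ i ∈ Finset.range (win + 1), pE i (X k - X j)) (m0 n : ℕ) (z : Zd d) :
    ∑ m ∈ Finset.Icc m0 n, bt (rng X T) m z ≤
      ∑ k ∈ Finset.range (T + win + 1), thw κ bad k *
        ∑ a ∈ Finset.Icc m0 (n + win), pE a (z - X k) := by
  set A := rng X T with hA
  have h1 : ∀ m, ∀ x ∈ A, bk A x m z ≤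
      (κ * ∑ j ∈ Finset.range (T + win + 1), ∑ i ∈ Finset.range (win + 1),
        bk A x m z * pE i (x - X j)) +
      ∑ k ∈ Finset.range (T + 1), if x = X k then (if bad k then 1 else 0) * pE m (z - X k) else 0 := by
    intro m x hx
    rw [hA, rng, Finset.mem_image] at hx
    obtain ⟨k, hk, rfl⟩ := hx
    by_cases hb : bad k
    · refine le_trans ?_ le_add_self
      refine le_trans ?_ (Finset.single_le_sum (fun _ _ => zero_le) hk)
      simpa [hb] using bk_le A (X k) m z
    · refine le_trans ?_ le_self_add
      simp_rw [← Finset.mul_sum]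
      rw [mul_left_comm]
      exact le_mul_of_one_le_right zero_le (hgood k (by simpa [Nat.lt_succ_iff] using hk) hb)
  calc ∑ m ∈ Finset.Icc m0 n, bt A m z
      ≤ ∑ m ∈ Finset.Icc m0 n, ∑ x ∈ A, ((κ * ∑ j ∈ Finset.range (T + win + 1), ∑ i ∈ Finset.range (win + 1),
        bk A x m z * pE i (x - X j)) +
      ∑ k ∈ Finset.range (T + 1), if x = X k then (if bad k then 1 else 0) * pE m (z - X k) else 0) := by
        refine Finset.sum_le_sum fun m _ => ?_
        rw [bt_eq]
        exact Finset.sum_le_sum fun x hx => h1 m x hx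
    _ = κ * ∑ j ∈ Finset.range (T + win + 1), (∑ m ∈ Finset.Icc m0 n, ∑ i ∈ Finset.range (win + 1),
          ∑ x ∈ A, bk A x m z * pE i (x - X j)) +
        ∑ k ∈ Finset.range (T + 1), (if bad k then 1 else 0) * ∑ m ∈ Finset.Icc m0 n, pE m (z - X k) := by
        simp_rw [Finset.sum_add_distrib, ← Finset.mul_sum]
        congr 1
        · congr 1
          conv_rhs => rw [Finset.sum_comm]
          refine Finset.sum_congr rfl fun m _ => ?_
          simp_rw [Finset.mul_sum]
          rw [Finset.sum_comm]
          refine Finset.sum_congr rfl fun j _ => ?_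
          rw [Finset.sum_comm]
        · simp_rw [Finset.mul_sum]
          rw [Finset.sum_comm' (t' := Finset.Icc m0 n) (s' := fun _ => Finset.range (T + 1)) (by simp)]
          refine Finset.sum_congr rfl fun m _ => ?_
          rw [Finset.sum_comm]
          refine Finset.sum_congr rfl fun k hk => ?_
          rw [Finset.sum_ite_eq']
          rw [if_pos (show X k ∈ A from Finset.mem_image_of_mem X hk)]
    _ ≤ κ * ∑ j ∈ Finset.range (T + win + 1), ∑ a ∈ Finset.Icc m0 (n + win), pE a (z - X j) +
        ∑ k ∈ Finset.range (T + win + 1), (if bad k then 1 else 0) * ∑ m ∈ Finset.Icc m0 (n + win), pE m (z - X k) := by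
        gcongr with j hj k hk
        · refine (reindex (fun m i => ∑ x ∈ A, bk A x m z * pE i (x - X j)) m0 n win).trans ?_
          exact Finset.sum_le_sum fun a _ => first_entrance A (X j) a z
        · refine (Finset.sum_le_sum_of_subset (Finset.range_subset_range.2 (show T + 1 ≤ T + win + 1 by omega))).trans ?_
          refine Finset.sum_le_sum fun k _ => mul_le_mul' le_rfl ?_
          exact Finset.sum_le_sum_of_subset (Finset.Icc_subset_Icc_right (by omega))
    _ = _ := by
        rw [Finset.mul_sum, ← Finset.sum_add_distrib]
        refine Finset.sum_congr rfl fun k _ => ?_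
        rw [thw, add_mul]

lemma hit_bound_inf {d : ℕ} (X : ℕ → Zd d) (T win : ℕ) (κ : ℝ≥0∞) (bad : ℕ → Prop)
    (hgood : ∀ k ≤ T, ¬ bad k → 1 ≤ κ * ∑ j ∈ Finset.range (T + win + 1),
      ∑ i ∈ Finset.range (win + 1), pE i (X k - X j)) (z : Zd d) :
    ∑' l, bt (rng X T) l z ≤
      ∑ k ∈ Finset.range (T + win + 1), thw κ bad k * ∑' a, pE a (z - X k) := by
  rw [ENNReal.tsum_eq_iSup_nat]
  refine iSup_le fun N => ?_
  refine le_trans (Finset.sum_le_sum_of_subset (t := Finset.Icc 0 N) fun i hi => by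
    simp at hi ⊢; omega) ((hit_bound X T win κ bad hgood 0 N z).trans ?_)
  gcongr
  exact ENNReal.sum_le_tsum _

theorem det_bound {d : ℕ} (X : ℕ → Zd d) (T win : ℕ) (κ : ℝ≥0∞) (bad : ℕ → Prop)
    (hgood : ∀ k ≤ T, ¬ bad k → 1 ≤ κ * ∑ j ∈ Finset.range (T + win + 1),
      ∑ i ∈ Finset.range (win + 1), pE i (X k - X j)) (m0 n : ℕ) (hm : 1 ≤ m0) :
    ((n + 1 - m0 : ℕ) : ℝ≥0∞) * Dn (rng X T) n ≤
      ∑ k ∈ Finset.range (T + win + 1), ∑ j ∈ Finset.range (T + win + 1),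
        ∑ a ∈ Finset.Icc m0 (n + win), ∑' b,
          thw κ bad k * thw κ bad j * pE (a + b) (X k - X j) := by
  refine (Dn_sum_le _ n m0 hm).trans ?_
  calc _ ≤ ∑' z, (∑ k ∈ Finset.range (T + win + 1), thw κ bad k *
        ∑ a ∈ Finset.Icc m0 (n + win), pE a (z - X k)) *
        (∑ k ∈ Finset.range (T + win + 1), thw κ bad k * ∑' a, pE a (z - X k)) := by
        refine ENNReal.tsum_le_tsum fun z => ?_
        gcongr
        · exact hit_bound X T win κ bad hgood m0 n z
        · exact hit_bound_inf X T win κ bad hgood z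
    _ = _ := by
        simp_rw [Finset.sum_mul_sum]
        rw [Summable.tsum_finsetSum (fun _ _ => ENNReal.summable)]
        refine Finset.sum_congr rfl fun k _ => ?_
        rw [Summable.tsum_finsetSum (fun _ _ => ENNReal.summable)]
        refine Finset.sum_congr rfl fun j _ => ?_
        simp_rw [mul_mul_mul_comm (thw κ bad k), ENNReal.tsum_mul_left, Finset.sum_mul, ← Finset.mul_sum]
        congr 1
        rw [Summable.tsum_finsetSum (fun _ _ => ENNReal.summable)]
        refine Finset.sum_congr rfl fun a _ => ?_
        simp_rw [← ENNReal.tsum_mul_left]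
        rw [ENNReal.tsum_comm]
        simp_rw [pE_conv]

/-- Prepend a starting point to a path. -/
def pcons {d : ℕ} (x : Zd d) (ω : ℕ → Zd d) : ℕ → Zd d
  | 0 => x
  | t + 1 => ω t

/-- Time shift of a path. -/
def psh {d : ℕ} (a : ℕ) (ω : ℕ → Zd d) : ℕ → Zd d := fun t => ω (a + t)

/-- Expectation over the `n`-step simple random walk path from `x`. -/
def EE {d : ℕ} : ℕ → Zd d → ((ℕ → Zd d) → ℝ≥0∞) → ℝ≥0∞
  | 0, x, f => f (fun _ => x)
  | n + 1, x, f => ((2 * d : ℕ) : ℝ≥0∞)⁻¹ * ∑ s : Step d, EE n (x + sv s) (fun ω => f (pcons x ω))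

lemma EE_mono_start {d : ℕ} (n : ℕ) (x : Zd d) {f g : (ℕ → Zd d) → ℝ≥0∞}
    (h : ∀ ω, ω 0 = x → f ω ≤ g ω) : EE n x f ≤ EE n x g := by
  induction n generalizing x f g with
  | zero => exact h _ rfl
  | succ n ih =>
    simp only [EE]
    gcongr with s
    exact ih _ fun ω _ => h _ rfl

lemma EE_mono {d : ℕ} (n : ℕ) (x : Zd d) {f g : (ℕ → Zd d) → ℝ≥0∞}
    (h : ∀ ω, f ω ≤ g ω) : EE n x f ≤ EE n x g := EE_mono_start n x fun ω _ => h ω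

lemma EE_congr_start {d : ℕ} (n : ℕ) (x : Zd d) {f g : (ℕ → Zd d) → ℝ≥0∞}
    (h : ∀ ω, ω 0 = x → f ω = g ω) : EE n x f = EE n x g :=
  le_antisymm (EE_mono_start n x fun ω hω => (h ω hω).le)
    (EE_mono_start n x fun ω hω => (h ω hω).ge)

lemma EE_const_mul {d : ℕ} (n : ℕ) (x : Zd d) (c : ℝ≥0∞) (f : (ℕ → Zd d) → ℝ≥0∞) :
    EE n x (fun ω => c * f ω) = c * EE n x f := by
  induction n generalizing x f with
  | zero => rfl
  | succ n ih =>
    simp only [EE]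
    rw [mul_left_comm c, Finset.mul_sum (a := c)]
    congr 1
    exact Finset.sum_congr rfl fun s _ => ih _ _

lemma EE_sum {d : ℕ} {ι : Type*} (F : Finset ι) (n : ℕ) (x : Zd d)
    (f : ι → (ℕ → Zd d) → ℝ≥0∞) :
    EE n x (fun ω => ∑ i ∈ F, f i ω) = ∑ i ∈ F, EE n x (f i) := by
  induction n generalizing x f with
  | zero => rfl
  | succ n ih =>
    simp only [EE]
    rw [← Finset.mul_sum, Finset.sum_comm]
    congr 1
    exact Finset.sum_congr rfl fun s _ => ih _ (fun i ω => f i (pcons x ω))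

lemma EE_add {d : ℕ} (n : ℕ) (x : Zd d) (f g : (ℕ → Zd d) → ℝ≥0∞) :
    EE n x (fun ω => f ω + g ω) = EE n x f + EE n x g := by
  have := EE_sum (Finset.univ : Finset Bool) n x (fun b => if b then f else g)
  simpa using this

lemma EE_tsum {d : ℕ} (n : ℕ) (x : Zd d)
    (f : ℕ → (ℕ → Zd d) → ℝ≥0∞) :
    EE n x (fun ω => ∑' i, f i ω) = ∑' i, EE n x (f i) := by
  induction n generalizing x f with
  | zero => rfl
  | succ n ih =>
    simp only [EE]
    rw [ENNReal.tsum_mul_left, Summable.tsum_finsetSum (fun _ _ => ENNReal.summable)]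
    congr 1
    exact Finset.sum_congr rfl fun s _ => ih _ (fun i ω => f i (pcons x ω))

lemma EE_const {d : ℕ} (hd : 0 < d) (n : ℕ) (x : Zd d) (c : ℝ≥0∞) :
    EE n x (fun _ => c) = c := by
  induction n generalizing x with
  | zero => rfl
  | succ n ih =>
    simp only [EE, ih]
    simp only [Finset.sum_const, Finset.card_univ, Fintype.card_prod, Fintype.card_fin,
      Fintype.card_bool, nsmul_eq_mul]
    rw [← mul_assoc, mul_comm d 2, ENNReal.inv_mul_cancel, one_mul]
    · simp; omega
    · exact ENNReal.natCast_ne_top _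

/-- `F` depends only on the path up to time `a`. -/
def Dep {d : ℕ} {β : Type*} (a : ℕ) (F : (ℕ → Zd d) → β) : Prop :=
  ∀ ω ω' : ℕ → Zd d, (∀ t ≤ a, ω t = ω' t) → F ω = F ω'

lemma EE_markov {d : ℕ} (a b : ℕ) (x : Zd d) (F G : (ℕ → Zd d) → ℝ≥0∞) (hF : Dep a F) :
    EE (a + b) x (fun ω => F ω * G (psh a ω)) = EE a x (fun ω => F ω * EE b (ω a) G) := by
  induction a generalizing x F with
  | zero =>
    rw [zero_add]
    simp only [EE]
    rw [← EE_const_mul]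
    refine EE_congr_start b x fun ω hω => ?_
    have h1 : F ω = F (fun _ => x) := hF _ _ fun t ht => by
      obtain rfl : t = 0 := by omega
      exact hω
    have h2 : psh 0 ω = ω := by ext t; simp [psh]
    rw [h1, h2]
  | succ a ih =>
    rw [show a + 1 + b = (a + b) + 1 by omega]
    simp only [EE]
    congr 1
    refine Finset.sum_congr rfl fun s _ => ?_
    have h := ih (x + sv s) (fun ω => F (pcons x ω)) (fun ω ω' h => hF _ _ fun t ht => by
      cases t with
      | zero => rfl
      | succ t => exact h t (by omega))
    refine Eq.trans ?_ h
    congr 1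
    ext ω
    congr 2
    ext t
    simp only [psh]
    rw [show a + 1 + t = (a + t) + 1 by omega]
    rfl

lemma EE_extend {d : ℕ} (hd : 0 < d) (a b : ℕ) (x : Zd d) (F : (ℕ → Zd d) → ℝ≥0∞) (hF : Dep a F) :
    EE (a + b) x F = EE a x F := by
  have := EE_markov a b x F (fun _ => 1) hF
  simpa [EE_const hd] using this

lemma pE_neg {d : ℕ} (t : ℕ) (x : Zd d) : pE t (-x) = pE t x := by
  induction t generalizing x with
  | zero => simp [pE]
  | succ t ih =>
    simp only [pE, Pop]
    rw [← Equiv.sum_comp negStep]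
    congr 1
    refine Finset.sum_congr rfl fun s _ => ?_
    rw [sv_neg, ← ih]
    congr 1; abel

lemma EE_pE {d : ℕ} (g c : ℕ) (x y : Zd d) :
    EE g y (fun ω => pE c (x - ω g)) = pE (c + g) (x - y) := by
  induction g generalizing y with
  | zero => rfl
  | succ g ih =>
    simp only [EE]
    have : ∀ s, EE g (y + sv s) (fun ω => pE c (x - pcons y ω (g + 1)))
      = pE (c + g) (x - (y + sv s)) := fun s => ih _
    simp_rw [this]
    rw [← add_assoc]
    simp only [pE, Pop]
    rw [← Equiv.sum_comp negStep]
    congr 1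
    refine Finset.sum_congr rfl fun s _ => ?_
    rw [sv_neg]
    congr 1; abel

lemma nn_step {d : ℕ} {x y : Zd d} (h : IsNN x y) : ∃ s : Step d, y = x + sv s := by
  unfold IsNN at h
  obtain ⟨i, -, hi⟩ : ∃ i ∈ Finset.univ, (x i - y i).natAbs ≠ 0 := by
    by_contra hc
    push Not at hc
    rw [Finset.sum_eq_zero hc] at h
    omega
  rw [← Finset.add_sum_erase _ _ (Finset.mem_univ i)] at h
  have h0 : ∑ j ∈ Finset.univ.erase i, (x j - y j).natAbs = 0 := by omega
  rw [Finset.sum_eq_zero_iff] at h0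
  have h1 : (x i - y i).natAbs = 1 := by omega
  refine ⟨(i, decide (x i < y i)), ?_⟩
  ext j
  by_cases hj : j = i
  · subst hj
    simp only [sv, Pi.add_apply, Pi.single_eq_same, decide_eq_true_eq]
    split_ifs <;> omega
  · have := h0 j (by simp [hj])
    simp only [sv, Pi.add_apply, Pi.single_apply, hj, if_false]
    omega

/-- Extend a finite path by its last point. -/
def pext {d : ℕ} (T : ℕ) (w : Fin (T + 1) → Zd d) : ℕ → Zd d :=
  fun t => w ⟨min t T, by omega⟩

/-- Cylinder weight. -/
def cylW {d : ℕ} (T : ℕ) (x : Zd d) (w : ℕ → Zd d) : ℝ≥0∞ :=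
  if w 0 = x ∧ ∀ t < T, IsNN (w t) (w (t + 1)) then (((2 * d : ℕ) : ℝ≥0∞))⁻¹ ^ T else 0

lemma cyl_sum_le {d : ℕ} (T : ℕ) (x : Zd d) (f : (ℕ → Zd d) → ℝ≥0∞) :
    ∑' w : Fin (T + 1) → Zd d, f (pext T w) * cylW T x (pext T w) ≤ EE T x f := by
  induction T generalizing x f with
  | zero =>
    simp only [EE]
    rw [tsum_eq_single (fun _ => x)]
    · have : pext 0 (fun _ => x) = fun _ => x := rfl
      rw [this]; simp [cylW]
    · intro w hw
      have : ¬ (pext 0 w 0 = x) := by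
        intro h; apply hw; ext i; rw [Fin.fin_one_eq_zero i]; rw [← h]; rfl
      simp [cylW, this]
  | succ T ih =>
    rw [← Equiv.tsum_eq (Fin.consEquiv (fun _ => Zd d)), ENNReal.tsum_prod' ]
    rw [tsum_eq_single x]
    swap
    · intro y hy
      rw [ENNReal.tsum_eq_zero]
      intro w
      have : pext (T + 1) (Fin.cons y w) 0 = y := rfl
      simp [cylW, Fin.consEquiv, this, hy]
    have hc : ∀ w : Fin (T + 1) → Zd d, pext (T + 1) (Fin.cons x w) = pcons x (pext T w) := by
      intro w
      ext1 t
      cases t with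
      | zero => rfl
      | succ t =>
        simp only [pext, pcons]
        have : (⟨min (t + 1) (T + 1), by omega⟩ : Fin (T + 1 + 1)) = Fin.succ ⟨min t T, by omega⟩ := by
          ext; simp
        rw [this, Fin.cons_succ]
    have hW : ∀ v : ℕ → Zd d, cylW (T + 1) x (pcons x v) ≤
        ((2 * d : ℕ) : ℝ≥0∞)⁻¹ * ∑ s : Step d, cylW T (x + sv s) v := by
      intro v
      conv_lhs => rw [cylW]
      split_ifs with h
      · rw [pow_succ']
        gcongr
        obtain ⟨s, hs⟩ := nn_step (h.2 0 (by omega))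
        refine le_trans ?_ (Finset.single_le_sum (fun _ _ => zero_le) (Finset.mem_univ s))
        rw [cylW, if_pos]
        refine ⟨hs, fun t ht => h.2 (t + 1) (by omega)⟩
      · exact zero_le
    simp only [EE, Fin.consEquiv, Equiv.coe_fn_mk]
    calc _ ≤ ∑' w : Fin (T + 1) → Zd d, ((2 * d : ℕ) : ℝ≥0∞)⁻¹ * ∑ s : Step d,
          f (pcons x (pext T w)) * cylW T (x + sv s) (pext T w) := by
          refine ENNReal.tsum_le_tsum fun w => ?_
          rw [hc, ← Finset.mul_sum, mul_left_comm]
          gcongr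
          exact hW _
      _ ≤ _ := by
          rw [ENNReal.tsum_mul_left, Summable.tsum_finsetSum (fun _ _ => ENNReal.summable)]
          gcongr with s
          exact ih (x + sv s) (fun ω => f (pcons x ω))

lemma bridge {d : ℕ} (x : Zd d) (P : Measure (ℕ → Zd d)) (hP : IsSRW d x P) (T : ℕ)
    (f : (ℕ → Zd d) → ℝ≥0∞) (hf : Dep T f) : ∫⁻ ω, f ω ∂P ≤ EE T x f := by
  refine le_trans (le_of_eq ?_) (cyl_sum_le T x f)
  let π : (ℕ → Zd d) → (Fin (T + 1) → Zd d) := fun ω i => ω i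
  have hπ : Measurable π := measurable_pi_lambda _ fun i => measurable_pi_apply _
  have h1 : ∀ ω, f ω = f (pext T (π ω)) := fun ω => hf _ _ fun t ht => by
    simp [pext, π, min_eq_left ht]
  calc ∫⁻ ω, f ω ∂P = ∫⁻ ω, f (pext T (π ω)) ∂P := lintegral_congr h1
    _ = ∫⁻ w, f (pext T w) ∂(P.map π) := by
      rw [lintegral_map (f := fun w => f (pext T w)) (measurable_of_countable _) hπ]
    _ = ∑' w, f (pext T w) * (P.map π) {w} := lintegral_countable' _
    _ = _ := by
      congr 1; ext w
      congr 1
      rw [Measure.map_apply hπ (measurableSet_singleton _), cylW, ← hP.2]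
      congr 1; ext ω
      simp only [Set.mem_preimage, Set.mem_singleton_iff, Set.mem_setOf_eq]
      constructor
      · rintro rfl t ht
        simp [pext, π, min_eq_left ht]
      · intro h
        ext1 i
        have := h i (by omega)
        simp only [π, this, pext]
        congr 1; ext; simp; omega

/-- Indicator that the first visit to `A` is at time `q`. -/
def fv {d : ℕ} (A : Finset (Zd d)) (q : ℕ) (ω : ℕ → Zd d) : ℝ≥0∞ :=
  if (∀ t < q, ω t ∉ A) ∧ ω q ∈ A then 1 else 0

lemma EE_fv {d : ℕ} (A : Finset (Zd d)) (q : ℕ) (x : Zd d) : EE q x (fv A q) = bt A q x := by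
  induction q generalizing x with
  | zero => simp [EE, fv, bt]
  | succ q ih =>
    simp only [EE, bt]
    have h : ∀ ω, fv A (q + 1) (pcons x ω) = (if x ∈ A then 0 else 1) * fv A q ω := by
      intro ω
      unfold fv
      have : (∀ t < q + 1, pcons x ω t ∉ A) ↔ x ∉ A ∧ ∀ t < q, ω t ∉ A := by
        constructor
        · intro h
          exact ⟨h 0 (by omega), fun t ht => h (t + 1) (by omega)⟩
        · rintro ⟨h1, h2⟩ t ht
          cases t with
          | zero => exact h1
          | succ t => exact h2 t (by omega)
      simp only [this]
      by_cases hx : x ∈ A <;> simp [hx, pcons]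
    simp_rw [h, EE_const_mul, ih]
    split_ifs <;> simp [Pop]

lemma ret_le {d : ℕ} (A : Finset (Zd d)) (q : ℕ) (x : Zd d) (P : Measure (ℕ → Zd d))
    (hP : IsSRW d x P) :
    P {ω | (∀ t < q, ω (t + 1) ∉ A) ∧ ω (q + 1) ∈ A} ≤ Pop (bt A q) x := by
  set E := {ω : ℕ → Zd d | (∀ t < q, ω (t + 1) ∉ A) ∧ ω (q + 1) ∈ A} with hE
  have hdep : Dep (q + 1) (fun ω : ℕ → Zd d => fv A q (fun t => ω (t + 1))) := by
    intro ω ω' h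
    have h1 : (∀ t < q, ω (t + 1) ∉ A) ↔ (∀ t < q, ω' (t + 1) ∉ A) := by
      refine forall₂_congr fun t ht => ?_
      rw [h (t + 1) (by omega)]
    simp only [fv, h1, h (q + 1) le_rfl]
  have h2 := bridge x P hP (q + 1) _ hdep
  have h3 : EE (q + 1) x (fun ω => fv A q (fun t => ω (t + 1))) = Pop (bt A q) x := by
    simp only [EE, Pop]
    congr 1
    refine Finset.sum_congr rfl fun s _ => ?_
    rw [← EE_fv]
    rfl
  rw [← h3]
  refine le_trans ?_ h2
  have hEm : MeasurableSet E := by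
    have : ∀ t, MeasurableSet {ω : ℕ → Zd d | ω t ∈ A} := fun t =>
      measurable_pi_apply t (Set.to_countable (A : Set (Zd d))).measurableSet
    have e : E = (⋂ t, ⋂ (_ : t < q), {ω : ℕ → Zd d | ω (t + 1) ∈ A}ᶜ) ∩ {ω | ω (q + 1) ∈ A} := by
      ext ω; simp [hE]
    rw [e]
    exact (MeasurableSet.iInter fun t => MeasurableSet.iInter fun _ => (this _).compl).inter (this _)
  rw [← lintegral_indicator_one hEm]
  refine lintegral_mono fun ω => ?_
  by_cases h : ω ∈ E
  · have : fv A q (fun t => ω (t + 1)) = 1 := by rw [fv, if_pos]; exact h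
    simp [h, this]
  · simp [h]

lemma cap_diff_le {d : ℕ} (Pw : Zd d → Measure (ℕ → Zd d)) (hPw : IsSRWFamily d Pw)
    (A : Finset (Zd d)) (R : ℝ) (n : ℕ) (hn : (n : ℝ) ≤ R / (Real.log R) ^ (10 : ℕ)) :
    ENNReal.ofReal (capTrunc Pw A R - capacity Pw A) ≤ Dn A n := by
  have key : ∀ x, Pw x (NoReturnUpTo (↑A) (R / (Real.log R) ^ (10 : ℕ))) ≤
      Pw x (NoReturn (↑A)) + ∑' l, Pop (bt A (n + l)) x := by
    intro x
    refine le_trans (measure_mono (t := NoReturn (↑A) ∪ ⋃ l : ℕ,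
      {ω | (∀ t < n + l, ω (t + 1) ∉ A) ∧ ω (n + l + 1) ∈ A}) ?_) ?_
    · intro ω hω
      by_cases h : ω ∈ NoReturn (↑A : Set (Zd d))
      · exact Or.inl h
      · right
        have hex : ∃ t, ω (t + 1) ∈ A := by
          unfold NoReturn at h
          simp only [Set.mem_setOf_eq, not_forall, not_not] at h
          obtain ⟨t, ht, h⟩ := h
          exact ⟨t - 1, by rw [Nat.sub_add_cancel ht]; exact h⟩
        have hmin := Nat.find_spec hex
        have hle : n ≤ Nat.find hex := by
          by_contra hc
          push Not at hc
          refine hω (Nat.find hex + 1) (by omega) (le_trans ?_ hn) hmin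
          exact_mod_cast hc
        rw [Set.mem_iUnion]
        refine ⟨Nat.find hex - n, ?_⟩
        rw [Nat.add_sub_cancel' hle]
        exact ⟨fun t ht => Nat.find_min hex ht, hmin⟩
    · refine (measure_union_le _ _).trans ?_
      gcongr
      refine (measure_iUnion_le _).trans ?_
      exact ENNReal.tsum_le_tsum fun l => ret_le A (n + l) x (Pw x) (hPw x)
  unfold capTrunc capacity Dn
  rw [← Finset.sum_sub_distrib]
  refine (Finset.le_sum_of_subadditive ENNReal.ofReal (by simp) (fun _ _ => ENNReal.ofReal_add_le) _ _).trans ?_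
  refine Finset.sum_le_sum fun x hx => ?_
  haveI := (hPw x).1
  rw [equil, if_pos (by exact_mod_cast hx)]
  rw [ENNReal.ofReal_sub _ ENNReal.toReal_nonneg, ENNReal.ofReal_toReal (measure_ne_top _ _),
    ENNReal.ofReal_toReal (measure_ne_top _ _)]
  rw [tsub_le_iff_left]
  exact key x

/-- Reduction of the integral to the expectation over finite paths. -/
lemma integral_le_EE {d : ℕ} (Pw : Zd d → Measure (ℕ → Zd d)) (hPw : IsSRWFamily d Pw)
    (R : ℝ) (T n N : ℕ) (hTN : T ≤ N) (hn : (n : ℝ) ≤ R / (Real.log R) ^ (10 : ℕ)) (B : ℝ) (hB : 0 ≤ B)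
    (hE : EE N (0 : Zd d) (fun ω => Dn (rng ω T) n) ≤ ENNReal.ofReal B) :
    (∫ ω, (capTrunc Pw (walkRange ω 0 T) R - capacity Pw (walkRange ω 0 T)) ∂ (Pw 0)) ≤ B := by
  have hdep : Dep N (fun ω : ℕ → Zd d => Dn (rng ω T) n) := by
    intro ω ω' h
    have : rng ω T = rng ω' T := by
      unfold rng
      refine Finset.image_congr fun t ht => h t ?_
      simp at ht; omega
    simp only [this]
  have h1 := (bridge 0 (Pw 0) (hPw 0) N _ hdep).trans hE
  have h2 : ∀ ω : ℕ → Zd d, walkRange ω 0 T = rng ω T := fun ω => by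
    unfold walkRange rng; congr 1; ext t; simp [Nat.lt_succ_iff]
  simp_rw [h2]
  by_cases hIntg : Integrable (fun ω => capTrunc Pw (rng ω T) R - capacity Pw (rng ω T)) (Pw 0)
  · rw [integral_eq_lintegral_pos_part_sub_lintegral_neg_part hIntg]
    refine (sub_le_self _ ENNReal.toReal_nonneg).trans ?_
    refine ENNReal.toReal_le_of_le_ofReal hB (le_trans ?_ h1)
    exact lintegral_mono fun ω => cap_diff_le Pw hPw (rng ω T) R n hn
  · rw [integral_undef hIntg]; exact hB

lemma pair_far {d : ℕ} (hd : 0 < d) (Θ : (ℕ → Zd d) → ℝ≥0∞) (win : ℕ) (hΘ : Dep win Θ) (τ : ℝ≥0∞)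
    (hτ : ∀ y, EE win y Θ ≤ τ) (k g e c : ℕ) (S : ℝ≥0∞) (hS : ∀ z : Zd d, pE (c + g) z ≤ S) (x : Zd d) :
    EE (k + (win + (g + (win + e)))) x (fun ω => Θ (psh k ω) * Θ (psh (k + (win + g)) ω) *
      pE c (ω k - ω (k + (win + g)))) ≤ τ * τ * S := by
  have step3 : ∀ y z : Zd d, EE (g + (win + e)) z (fun ζ => pE c (y - ζ g) * Θ (psh g ζ)) ≤ τ * S := by
    intro y z
    rw [EE_markov g (win + e) z (fun ζ => pE c (y - ζ g)) Θ
      (fun ω ω' h => by simp only [h g le_rfl])]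
    have : ∀ w, EE (win + e) w Θ ≤ τ := fun w => by rw [EE_extend hd _ _ _ _ hΘ]; exact hτ w
    calc _ ≤ EE g z (fun ζ => τ * pE c (y - ζ g)) := by
          refine EE_mono _ _ fun ω => ?_
          rw [mul_comm]
          exact mul_le_mul' (this _) le_rfl
      _ = τ * pE (c + g) (y - z) := by rw [EE_const_mul, EE_pE]
      _ ≤ _ := by gcongr; exact hS _
  have step2 : ∀ y : Zd d, EE (win + (g + (win + e))) y (fun η => Θ η * Θ (psh (win + g) η) *
      pE c (η 0 - η (win + g))) ≤ τ * τ * S := by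
    intro y
    have : EE (win + (g + (win + e))) y (fun η => Θ η * Θ (psh (win + g) η) *
      pE c (η 0 - η (win + g))) = EE (win + (g + (win + e))) y (fun η => Θ η *
        (fun ζ : ℕ → Zd d => pE c (y - ζ g) * Θ (psh g ζ)) (psh win η)) := by
      refine EE_congr_start _ _ fun ω hω => ?_
      have e : psh g (psh win ω) = psh (win + g) ω := by
        ext t; simp only [psh, add_assoc]
      simp only [e, hω]
      simp only [psh]
      ring
    rw [this, EE_markov win (g + (win + e)) y Θ (fun ζ : ℕ → Zd d => pE c (y - ζ g) * Θ (psh g ζ)) hΘ]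
    calc _ ≤ EE win y (fun ω => (τ * S) * Θ ω) := by
          refine EE_mono _ _ fun ω => ?_
          rw [mul_comm]
          exact mul_le_mul' (step3 _ _) le_rfl
      _ ≤ (τ * S) * τ := by rw [EE_const_mul]; gcongr; exact hτ y
      _ = _ := by ring
  have h := EE_markov k (win + (g + (win + e))) x (fun _ => 1) (fun η => Θ η * Θ (psh (win + g) η) *
      pE c (η 0 - η (win + g))) (fun _ _ _ => rfl)
  simp only [one_mul] at h
  have h' : EE (k + (win + (g + (win + e)))) x (fun ω => Θ (psh k ω) * Θ (psh (k + (win + g)) ω) *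
      pE c (ω k - ω (k + (win + g)))) = EE (k + (win + (g + (win + e)))) x (fun ω => Θ (psh k ω) *
        Θ (psh (win + g) (psh k ω)) * pE c (psh k ω 0 - psh k ω (win + g))) := by
    congr 1; ext ω
    have : psh (win + g) (psh k ω) = psh (k + (win + g)) ω := by
      ext t; simp only [psh, add_assoc]
    rw [this]
    rfl
  rw [h', h]
  refine (EE_mono _ _ fun ω => step2 (ω k)).trans ?_
  rw [EE_const hd]

lemma pair_near {d : ℕ} (hd : 0 < d) (Θ : (ℕ → Zd d) → ℝ≥0∞) (M : ℝ≥0∞) (hM : ∀ ω, Θ ω ≤ M)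
    (N k j c : ℕ) (S : ℝ≥0∞) (hS : ∀ z : Zd d, pE c z ≤ S) (x : Zd d) :
    EE N x (fun ω => Θ (psh k ω) * Θ (psh j ω) * pE c (ω k - ω j)) ≤ M * M * S := by
  refine (EE_mono _ _ fun ω => mul_le_mul' (mul_le_mul' (hM _) (hM _)) (hS _)).trans ?_
  rw [EE_const hd]

/-- Sum of bounds over the two time parameters. -/
def Phi (φ : ℕ → ℝ≥0∞) (m0 n win : ℕ) (g : ℕ) : ℝ≥0∞ :=
  ((n + win + 1 - m0 : ℕ) : ℝ≥0∞) * ∑' b, φ (m0 + b + g)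

lemma sum_le_Phi (φ : ℕ → ℝ≥0∞) (hφ : Antitone φ) (m0 n win g : ℕ) (K : ℝ≥0∞) :
    ∑ a ∈ Finset.Icc m0 (n + win), ∑' b, K * φ (a + b + g) ≤ K * Phi φ m0 n win g := by
  calc _ ≤ ∑ a ∈ Finset.Icc m0 (n + win), K * ∑' b, φ (m0 + b + g) := by
        refine Finset.sum_le_sum fun a ha => ?_
        rw [ENNReal.tsum_mul_left]
        refine mul_le_mul' le_rfl (ENNReal.tsum_le_tsum fun b => hφ ?_)
        rw [Finset.mem_Icc] at ha; omega
    _ = _ := by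
        simp [Phi]; ring

theorem expect_bound {d : ℕ} (hd : 0 < d) (B : (ℕ → Zd d) → Prop) (κ : ℝ≥0∞) (win : ℕ)
    (hB : Dep win B)
    (hgood : ∀ η : ℕ → Zd d, ¬ B η → 1 ≤ κ * ∑ j ∈ Finset.range (win + 1),
      ∑ i ∈ Finset.range (win + 1), pE i (η 0 - η j))
    (τ : ℝ≥0∞) (hτ : ∀ y, EE win y (fun ω => κ + if B ω then 1 else 0) ≤ τ)
    (M : ℝ≥0∞) (hM : κ + 1 ≤ M) (T m0 n : ℕ) (hm : 1 ≤ m0) (φ : ℕ → ℝ≥0∞) (hφ : Antitone φ)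
    (hpφ : ∀ t, m0 ≤ t → ∀ z : Zd d, pE t z ≤ φ t) :
    ((n + 1 - m0 : ℕ) : ℝ≥0∞) * EE (T + win + win) (0 : Zd d) (fun ω => Dn (rng ω T) n) ≤
      ((T + win + 1 : ℕ) : ℝ≥0∞) * (((2 * win + 1 : ℕ) : ℝ≥0∞) * (M * M * Phi φ m0 n win 0) +
        2 * ∑ g ∈ Finset.range (T + win + 1), τ * τ * Phi φ m0 n win g) := by
  set Θ : (ℕ → Zd d) → ℝ≥0∞ := fun ω => κ + if B ω then 1 else 0 with hΘdef
  have hΘ : Dep win Θ := fun ω ω' h => by simp only [hΘdef, hB ω ω' h]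
  have hΘM : ∀ ω, Θ ω ≤ M := fun ω => by
    refine le_trans ?_ hM
    simp only [hΘdef]; gcongr; split_ifs <;> simp
  set N := T + win + win with hN
  have hW : ∀ k ∈ Finset.range (T + win + 1), ∀ j ∈ Finset.range (T + win + 1),
      ∑ a ∈ Finset.Icc m0 (n + win), ∑' b, EE N (0 : Zd d) (fun ω => Θ (psh k ω) * Θ (psh j ω) *
        pE (a + b) (ω k - ω j)) ≤
      (if j ∈ Finset.Icc (k - win) (k + win) then M * M * Phi φ m0 n win 0 else 0) +
      ((if k + win ≤ j then τ * τ * Phi φ m0 n win (j - k - win) else 0) +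
      (if j + win ≤ k then τ * τ * Phi φ m0 n win (k - j - win) else 0)) := by
    have far : ∀ k ∈ Finset.range (T + win + 1), ∀ j ∈ Finset.range (T + win + 1), k + win ≤ j →
        ∑ a ∈ Finset.Icc m0 (n + win), ∑' b, EE N (0 : Zd d) (fun ω => Θ (psh k ω) * Θ (psh j ω) *
        pE (a + b) (ω k - ω j)) ≤ τ * τ * Phi φ m0 n win (j - k - win) := by
      intro k hk j hj hkj
      rw [Finset.mem_range] at hk hj
      refine le_trans ?_ (sum_le_Phi φ hφ m0 n win (j - k - win) (τ * τ))
      refine Finset.sum_le_sum fun a ha => ENNReal.tsum_le_tsum fun b => ?_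
      rw [Finset.mem_Icc] at ha
      have h := pair_far hd Θ win hΘ τ hτ k (j - k - win) (T + win - j) (a + b)
        (φ (a + b + (j - k - win))) (fun z => hpφ _ (by omega) z) 0
      rw [show k + (win + (j - k - win)) = j by omega,
        show k + (win + (j - k - win + (win + (T + win - j)))) = N by omega] at h
      exact h
    intro k hk j hj
    by_cases h1 : k + win ≤ j
    · refine (far k hk j hj h1).trans ?_
      rw [if_pos h1]
      exact le_add_left le_self_add
    by_cases h2 : j + win ≤ k
    · have := far j hj k hk h2
      simp_rw [mul_comm (Θ (psh j _))] at this
      have e : ∀ (ω : ℕ → Zd d) c, pE c (ω k - ω j) = pE c (ω j - ω k) := fun ω c => by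
        rw [← pE_neg, neg_sub]
      simp_rw [e]
      refine this.trans ?_
      rw [if_pos h2]
      exact le_add_left le_add_self
    · rw [if_pos (by rw [Finset.mem_Icc]; omega)]
      refine le_trans ?_ le_self_add
      refine le_trans ?_ (sum_le_Phi φ hφ m0 n win 0 (M * M))
      refine Finset.sum_le_sum fun a ha => ENNReal.tsum_le_tsum fun b => ?_
      rw [Finset.mem_Icc] at ha
      exact pair_near hd Θ M hΘM N k j (a + b) _ (fun z => hpφ _ (by omega) z) 0
  calc _ = EE N (0 : Zd d) (fun ω => ((n + 1 - m0 : ℕ) : ℝ≥0∞) * Dn (rng ω T) n) := by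
        rw [EE_const_mul]
    _ ≤ EE N (0 : Zd d) (fun ω => ∑ k ∈ Finset.range (T + win + 1), ∑ j ∈ Finset.range (T + win + 1),
        ∑ a ∈ Finset.Icc m0 (n + win), ∑' b, Θ (psh k ω) * Θ (psh j ω) *
        pE (a + b) (ω k - ω j)) := by
        refine EE_mono _ _ fun ω => ?_
        refine det_bound ω T win κ (fun k => B (psh k ω)) ?_ m0 n hm
        intro k hk hb
        refine (hgood _ hb).trans ?_
        refine mul_le_mul' le_rfl ?_
        have : ∑ j ∈ Finset.range (win + 1), ∑ i ∈ Finset.range (win + 1), pE i (psh k ω 0 - psh k ω j)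
            = ∑ j ∈ (Finset.range (win + 1)).map (addLeftEmbedding k), ∑ i ∈ Finset.range (win + 1),
              pE i (ω k - ω j) := by
          rw [Finset.sum_map]; rfl
        rw [this]
        refine Finset.sum_le_sum_of_subset fun j hj => ?_
        simp only [Finset.mem_map, Finset.mem_range, addLeftEmbedding_apply] at hj ⊢
        omega
    _ = ∑ k ∈ Finset.range (T + win + 1), ∑ j ∈ Finset.range (T + win + 1),
        ∑ a ∈ Finset.Icc m0 (n + win), ∑' b, EE N (0 : Zd d) (fun ω => Θ (psh k ω) * Θ (psh j ω) *
        pE (a + b) (ω k - ω j)) := by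
        simp_rw [EE_sum, EE_tsum]
    _ ≤ ∑ k ∈ Finset.range (T + win + 1), (((2 * win + 1 : ℕ) : ℝ≥0∞) * (M * M * Phi φ m0 n win 0) +
        2 * ∑ g ∈ Finset.range (T + win + 1), τ * τ * Phi φ m0 n win g) := by
        refine Finset.sum_le_sum fun k hk => ?_
        refine (Finset.sum_le_sum fun j hj => hW k hk j hj).trans ?_
        rw [Finset.sum_add_distrib, Finset.sum_add_distrib, two_mul (∑ g ∈ Finset.range (T + win + 1), τ * τ * Phi φ m0 n win g)]
        refine add_le_add ?_ (add_le_add ?_ ?_)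
        · rw [← Finset.sum_filter, Finset.sum_const, nsmul_eq_mul]
          gcongr
          refine (Finset.card_le_card (t := Finset.Icc (k - win) (k + win)) fun j hj => ?_).trans ?_
          · exact (Finset.mem_filter.1 hj).2
          · simp; omega
        · rw [← Finset.sum_filter]
          rw [← Finset.sum_image (s := (Finset.range (T + win + 1)).filter (fun j => k + win ≤ j))
            (g := fun j => j - k - win) (f := fun g => τ * τ * Phi φ m0 n win g)]
          · refine Finset.sum_le_sum_of_subset fun g hg => ?_
            simp only [Finset.mem_image, Finset.mem_filter, Finset.mem_range] at hg ⊢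
            omega
          · intro a ha b hb hab
            simp only [Finset.coe_filter, Finset.mem_range, Set.mem_setOf_eq] at ha hb hab
            omega
        · rw [← Finset.sum_filter]
          rw [← Finset.sum_image (s := (Finset.range (T + win + 1)).filter (fun j => j + win ≤ k))
            (g := fun j => k - j - win) (f := fun g => τ * τ * Phi φ m0 n win g)]
          · refine Finset.sum_le_sum_of_subset fun g hg => ?_
            simp only [Finset.mem_image, Finset.mem_filter, Finset.mem_range] at hg hk ⊢
            omega
          · intro a ha b hb hab
            simp only [Finset.coe_filter, Finset.mem_range, Set.mem_setOf_eq] at ha hb hab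
            omega
    _ = _ := by rw [Finset.sum_const, Finset.card_range, nsmul_eq_mul]

lemma EE_at {d : ℕ} (t : ℕ) (y : Zd d) (f : Zd d → ℝ≥0∞) :
    EE t y (fun ω => f (ω t)) = ∑' x, pE t (y - x) * f x := by
  induction t generalizing y with
  | zero =>
    simp only [EE]
    rw [tsum_eq_single y]
    · simp [pE]
    · intro x hx; simp [pE, sub_eq_zero, hx.symm]
  | succ t ih =>
    simp only [EE]
    have : ∀ s, EE t (y + sv s) (fun ω => f (pcons y ω (t + 1))) = ∑' x, pE t (y + sv s - x) * f x :=
      fun s => ih _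
    simp_rw [this]
    rw [← Summable.tsum_finsetSum (fun _ _ => ENNReal.summable), ← ENNReal.tsum_mul_left]
    congr 1; ext x
    rw [← Finset.sum_mul, ← mul_assoc]
    congr 1
    simp only [pE, Pop]
    congr 1
    refine Finset.sum_congr rfl fun s _ => ?_
    congr 1; abel

/-- Return probability at time `2 * t`. -/
def uE (d : ℕ) (t : ℕ) : ℝ≥0∞ := pE (2 * t) (0 : Zd d)

lemma pE_le_uE {d : ℕ} (hd : 0 < d) (t : ℕ) (x : Zd d) : pE (2 * t) x ≤ uE d t := by
  rw [uE, pE_eq hd, pE_eq hd]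
  exact ENNReal.ofReal_le_ofReal (pR_even_le t x)

/-- Triple overlap. -/
def S3 (d : ℕ) (a b c : ℕ) : ℝ≥0∞ := ∑' x : Zd d, pE (2 * a) x * pE (2 * b) x * pE (2 * c) x

lemma pE_conv0 (d a b : ℕ) : ∑' x : Zd d, pE (2 * a) x * pE (2 * b) x = uE d (a + b) := by
  have := pE_conv (2 * a) (2 * b) (0 : Zd d) 0
  simp only [sub_zero] at this
  rw [this, uE, mul_add]

lemma S3_le1 {d : ℕ} (hd : 0 < d) (a b c : ℕ) : S3 d a b c ≤ uE d (a + b) * uE d c := by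
  rw [← pE_conv0, ← ENNReal.tsum_mul_right]
  exact ENNReal.tsum_le_tsum fun x => mul_le_mul' le_rfl (pE_le_uE hd c x)

lemma S3_perm1 (d a b c : ℕ) : S3 d a b c = S3 d b a c := by
  unfold S3; simp_rw [mul_comm (pE (2 * a) _)]

lemma S3_perm2 (d a b c : ℕ) : S3 d a b c = S3 d a c b := by
  unfold S3; simp_rw [mul_assoc, mul_comm (pE (2 * b) _)]

lemma S3_le2 {d : ℕ} (hd : 0 < d) (a b c : ℕ) : S3 d a b c ≤ uE d b * uE d (a + c) := by
  rw [S3_perm2, mul_comm]; exact S3_le1 hd _ _ _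

lemma S3_le3 {d : ℕ} (hd : 0 < d) (a b c : ℕ) : S3 d a b c ≤ uE d a * uE d (b + c) := by
  rw [S3_perm1]; exact S3_le2 hd _ _ _

lemma EE_pair {d : ℕ} (hd : 0 < d) (v : ℕ) (y : Zd d) (j l i i' : ℕ) (hjl : j ≤ l) (hl : l ≤ v) :
    EE (2 * v) y (fun ω => pE (2 * i) (y - ω (2 * j)) * pE (2 * i') (y - ω (2 * l)))
      = S3 d j i (l - j + i') := by
  have h := EE_markov (2 * j) (2 * v - 2 * j) y (fun ω => pE (2 * i) (y - ω (2 * j)))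
    (fun ζ => pE (2 * i') (y - ζ (2 * (l - j)))) (fun ω ω' h => by simp only [h _ le_rfl])
  rw [show 2 * j + (2 * v - 2 * j) = 2 * v by omega] at h
  have e : ∀ ω : ℕ → Zd d, psh (2 * j) ω (2 * (l - j)) = ω (2 * l) := fun ω => by
    rw [psh]; congr 1; omega
  simp_rw [e] at h
  rw [h]
  have h2 : ∀ z : Zd d, EE (2 * v - 2 * j) z (fun ζ => pE (2 * i') (y - ζ (2 * (l - j))))
      = pE (2 * (l - j + i')) (y - z) := by
    intro z
    rw [show 2 * v - 2 * j = 2 * (l - j) + 2 * (v - l) by omega]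
    rw [EE_extend hd _ _ _ _ (fun ω ω' h => by simp only [h _ le_rfl]), EE_pE]
    congr 1; omega
  simp_rw [h2]
  rw [EE_at (2 * j) y (fun x => pE (2 * i) (y - x) * pE (2 * (l - j + i')) (y - x))]
  unfold S3
  rw [← Equiv.tsum_eq (Equiv.subLeft y)]
  simp [mul_assoc]

/-- Local time functional. -/
def LL {d : ℕ} (v : ℕ) (ω : ℕ → Zd d) : ℝ≥0∞ :=
  ∑ j ∈ Finset.range (v + 1), ∑ i ∈ Finset.range (v + 1), pE (2 * i) (ω 0 - ω (2 * j))

/-- Its mean. -/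
def mm (d v : ℕ) : ℝ≥0∞ :=
  ∑ j ∈ Finset.range (v + 1), ∑ i ∈ Finset.range (v + 1), uE d (j + i)

lemma EE_LL {d : ℕ} (hd : 0 < d) (v : ℕ) (y : Zd d) : EE (2 * v) y (LL v) = mm d v := by
  have : EE (2 * v) y (LL v) = EE (2 * v) y (fun ω => ∑ j ∈ Finset.range (v + 1),
      ∑ i ∈ Finset.range (v + 1), pE (2 * i) (y - ω (2 * j))) :=
    EE_congr_start _ _ fun ω hω => by rw [LL, hω]
  rw [this]
  simp_rw [EE_sum]
  unfold mm
  refine Finset.sum_congr rfl fun j hj => Finset.sum_congr rfl fun i _ => ?_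
  rw [Finset.mem_range] at hj
  rw [show 2 * v = 2 * j + 2 * (v - j) by omega,
    EE_extend hd _ _ _ _ (fun ω ω' h => by simp only [h _ le_rfl]), EE_pE, sub_self, uE]
  congr 1; omega

lemma sq_le_two_mul (v : ℕ) (A : ℕ → ℝ≥0∞) :
    (∑ j ∈ Finset.range v, A j) * (∑ j ∈ Finset.range v, A j) ≤
      2 * ∑ j ∈ Finset.range v, ∑ l ∈ Finset.range v, if j ≤ l then A j * A l else 0 := by
  rw [Finset.sum_mul_sum, two_mul]
  nth_rewrite 3 [Finset.sum_comm]
  rw [← Finset.sum_add_distrib]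
  refine Finset.sum_le_sum fun j _ => ?_
  rw [← Finset.sum_add_distrib]
  refine Finset.sum_le_sum fun l _ => ?_
  rcases le_total j l with h | h
  · rw [if_pos h]; exact le_self_add
  · rw [if_pos h, mul_comm]; exact le_add_self

lemma EE_LLsq_le {d : ℕ} (hd : 0 < d) (v : ℕ) (y : Zd d) :
    EE (2 * v) y (fun ω => LL v ω * LL v ω) ≤
      2 * ∑ j ∈ Finset.range (v + 1), ∑ i ∈ Finset.range (v + 1), ∑ l ∈ Finset.range (v + 1),
        ∑ i' ∈ Finset.range (v + 1), S3 d j i (l + i') := by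
  have h1 : EE (2 * v) y (fun ω => LL v ω * LL v ω) ≤ EE (2 * v) y (fun ω => 2 *
      ∑ j ∈ Finset.range (v + 1), ∑ l ∈ Finset.range (v + 1), if j ≤ l then
        ∑ i ∈ Finset.range (v + 1), ∑ i' ∈ Finset.range (v + 1),
          pE (2 * i) (y - ω (2 * j)) * pE (2 * i') (y - ω (2 * l)) else 0) := by
    refine EE_mono_start _ _ fun ω hω => ?_
    rw [LL, hω]
    simp_rw [← Finset.sum_mul_sum]
    exact sq_le_two_mul (v + 1) (fun j => ∑ i ∈ Finset.range (v + 1), pE (2 * i) (y - ω (2 * j)))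
  refine h1.trans ?_
  rw [EE_const_mul]
  gcongr
  rw [EE_sum]
  refine Finset.sum_le_sum fun j hj => ?_
  rw [EE_sum]
  rw [Finset.sum_comm (s := Finset.range (v + 1)) (t := Finset.range (v + 1))
    (f := fun i l => ∑ i' ∈ Finset.range (v + 1), S3 d j i (l + i'))]
  have h2 : ∀ l ∈ Finset.range (v + 1), EE (2 * v) y (fun ω => if j ≤ l then
        ∑ i ∈ Finset.range (v + 1), ∑ i' ∈ Finset.range (v + 1),
          pE (2 * i) (y - ω (2 * j)) * pE (2 * i') (y - ω (2 * l)) else 0) =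
        if j ≤ l then ∑ i ∈ Finset.range (v + 1), ∑ i' ∈ Finset.range (v + 1),
          S3 d j i (l - j + i') else 0 := by
    intro l hl
    rw [Finset.mem_range] at hl
    split_ifs with h
    · simp_rw [EE_sum]
      refine Finset.sum_congr rfl fun i _ => Finset.sum_congr rfl fun i' _ => ?_
      exact EE_pair hd v y j l i i' h (by omega)
    · exact EE_const hd _ _ _
  rw [Finset.sum_congr rfl h2, ← Finset.sum_filter]
  rw [← Finset.sum_image (s := (Finset.range (v + 1)).filter (fun l => j ≤ l))
    (g := fun l => l - j) (f := fun l => ∑ i ∈ Finset.range (v + 1), ∑ i' ∈ Finset.range (v + 1),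
          S3 d j i (l + i'))]
  · refine Finset.sum_le_sum_of_subset fun g hg => ?_
    simp only [Finset.mem_image, Finset.mem_filter, Finset.mem_range] at hg ⊢
    omega
  · intro a ha b hb hab
    simp only [Finset.coe_filter, Finset.mem_range, Set.mem_ofPred_eq] at ha hb hab
    omega

/-- ties -/
def tieS (d v : ℕ) : ℝ≥0∞ := ∑ j ∈ Finset.range (v + 1), ∑ i ∈ Finset.range (v + 1),
  ∑ l ∈ Finset.range (v + 1), ∑ i' ∈ Finset.range (v + 1),
    if j + i = l + i' then uE d (j + i) * uE d (l + i') else 0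

/-- off part -/
def offS (d v : ℕ) : ℝ≥0∞ := ∑ j ∈ Finset.range (v + 1), ∑ i ∈ Finset.range (v + 1),
  ∑ l ∈ Finset.range (v + 1), ∑ i' ∈ Finset.range (v + 1),
    if j ≤ i ∧ l + i' < j + i then uE d i * uE d (j + (l + i')) else 0

lemma second_moment {d : ℕ} (hd : 0 < d) (v : ℕ) (y : Zd d) :
    EE (2 * v) y (fun ω => LL v ω * LL v ω) ≤ mm d v * mm d v + (tieS d v + 4 * offS d v) := by
  refine (EE_LLsq_le hd v y).trans ?_
  set R := Finset.range (v + 1)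
  have h1 : ∀ j i l i', S3 d j i (l + i') ≤
      (if j + i ≤ l + i' then uE d (j + i) * uE d (l + i') else 0) +
      ((if j ≤ i ∧ l + i' < j + i then uE d i * uE d (j + (l + i')) else 0) +
       (if i ≤ j ∧ l + i' < i + j then uE d j * uE d (i + (l + i')) else 0)) := by
    intro j i l i'
    by_cases h : j + i ≤ l + i'
    · rw [if_pos h]; exact (S3_le1 hd _ _ _).trans le_self_add
    · refine le_trans ?_ le_add_self
      rcases le_total j i with h2 | h2
      · rw [if_pos ⟨h2, by omega⟩]; exact (S3_le2 hd _ _ _).trans le_self_add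
      · rw [if_pos (show i ≤ j ∧ l + i' < i + j from ⟨h2, by omega⟩)]
        exact (S3_le3 hd _ _ _).trans le_add_self
  set X := ∑ j ∈ R, ∑ i ∈ R, ∑ l ∈ R, ∑ i' ∈ R,
    (if j + i ≤ l + i' then uE d (j + i) * uE d (l + i') else 0) with hX
  have hO2 : ∑ j ∈ R, ∑ i ∈ R, ∑ l ∈ R, ∑ i' ∈ R,
      (if i ≤ j ∧ l + i' < i + j then uE d j * uE d (i + (l + i')) else 0) = offS d v := by
    rw [Finset.sum_comm]; rfl
  have h2 : ∑ j ∈ R, ∑ i ∈ R, ∑ l ∈ R, ∑ i' ∈ R, S3 d j i (l + i') ≤ X + (offS d v + offS d v) := by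
    refine (Finset.sum_le_sum fun j _ => Finset.sum_le_sum fun i _ => Finset.sum_le_sum fun l _ =>
      Finset.sum_le_sum fun i' _ => h1 j i l i').trans (le_of_eq ?_)
    simp_rw [Finset.sum_add_distrib]
    rw [hO2]
    rfl
  have hX2 : X = ∑ j ∈ R, ∑ i ∈ R, ∑ l ∈ R, ∑ i' ∈ R,
    (if l + i' ≤ j + i then uE d (j + i) * uE d (l + i') else 0) := by
    rw [hX]
    simp_rw [← Finset.sum_product' (s := R) (t := R) (f := fun j i => ∑ l ∈ R, ∑ i' ∈ R, _)]
    simp_rw [← Finset.sum_product' (s := R) (t := R)]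
    rw [Finset.sum_comm]
    simp_rw [mul_comm]
  have h3 : X + X = mm d v * mm d v + tieS d v := by
    nth_rewrite 2 [hX2]
    have hmm : mm d v * mm d v = ∑ j ∈ R, ∑ i ∈ R, ∑ l ∈ R, ∑ i' ∈ R, uE d (j + i) * uE d (l + i') := by
      unfold mm
      simp_rw [← Finset.mul_sum, ← Finset.sum_mul]
      rfl
    have htie : tieS d v = ∑ j ∈ R, ∑ i ∈ R, ∑ l ∈ R, ∑ i' ∈ R,
      if j + i = l + i' then uE d (j + i) * uE d (l + i') else 0 := rfl
    rw [hX, hmm, htie]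
    simp_rw [← Finset.sum_add_distrib]
    refine Finset.sum_congr rfl fun j _ => Finset.sum_congr rfl fun i _ => Finset.sum_congr rfl fun l _ =>
      Finset.sum_congr rfl fun i' _ => ?_
    rcases lt_trichotomy (j + i) (l + i') with h | h | h
    · simp [h.le, h.ne, h.not_ge]
    · simp [h]
    · simp [h.le, h.ne', h.not_ge]
  calc _ ≤ 2 * (X + (offS d v + offS d v)) := by gcongr
    _ = (X + X) + 4 * offS d v := by ring
    _ = _ := by rw [h3, add_assoc]

/-- Harmonic sum. -/
def Hs (v : ℕ) : ℝ := ∑ i ∈ Finset.range (v + 1), 1 / ((i : ℝ) + 1)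

lemma Hs_ge_one (v : ℕ) : 1 ≤ Hs v := by
  unfold Hs
  rw [Finset.sum_range_succ']
  have : 0 ≤ ∑ k ∈ Finset.range v, 1 / (((k + 1 : ℕ) : ℝ) + 1) := Finset.sum_nonneg fun _ _ => by positivity
  simp; simpa using this

lemma sum_inv_sq_le (a : ℝ) (ha : 0 ≤ a) (N : ℕ) :
    ∑ b ∈ Finset.range N, 1 / (a + b + 1) ^ 2 ≤ 2 / (a + 1) - 2 / (a + N + 1) := by
  induction N with
  | zero => simp
  | succ N ih =>
    rw [Finset.sum_range_succ]
    have hx : (1 : ℝ) ≤ a + N + 1 := by have : (0 : ℝ) ≤ N := by positivity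
                                        linarith
    set x := a + N + 1 with hxdef
    have e : a + ((N + 1 : ℕ) : ℝ) + 1 = x + 1 := by push_cast; ring
    rw [e]
    have : 1 / x ^ 2 ≤ 2 / x - 2 / (x + 1) := by
      have hx0 : 0 < x := by linarith
      rw [div_sub_div _ _ hx0.ne' (by linarith), div_le_div_iff₀ (by positivity) (by positivity)]
      nlinarith
    linarith

lemma sum_inv_sq_le' (a : ℝ) (ha : 0 ≤ a) (N : ℕ) :
    ∑ b ∈ Finset.range N, 1 / (a + b + 1) ^ 2 ≤ 2 / (a + 1) :=
  (sum_inv_sq_le a ha N).trans (sub_le_self _ (by positivity))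

lemma sum_inv_sqrt_le (N : ℕ) :
    ∑ b ∈ Finset.range N, 1 / √((b : ℝ) + 1) ≤ 2 * √N := by
  induction N with
  | zero => simp
  | succ N ih =>
    rw [Finset.sum_range_succ]
    have h1 : √((N : ℝ)) ^ 2 = N := Real.sq_sqrt (by positivity)
    have h2 : √((N : ℝ) + 1) ^ 2 = N + 1 := Real.sq_sqrt (by positivity)
    have h3 : √((N : ℝ)) ≤ √((N : ℝ) + 1) := Real.sqrt_le_sqrt (by linarith)
    have h4 : 0 < √((N : ℝ) + 1) := Real.sqrt_pos.2 (by positivity)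
    have : 1 / √((N : ℝ) + 1) ≤ 2 * √((N : ℝ) + 1) - 2 * √N := by
      rw [div_le_iff₀ h4]
      nlinarith [sq_nonneg (√((N : ℝ) + 1) - √N)]
    push_cast
    linarith

lemma sum2_le (i : ℕ) (N : ℕ) (hN : N ≤ 2 * (i + 1)) :
    ∑ j ∈ Finset.range (i + 1), ∑ l ∈ Finset.range N, 1 / ((j : ℝ) + l + 1) ≤ 8 * ((i : ℝ) + 1) := by
  have h : ∀ j l : ℕ, 1 / ((j : ℝ) + l + 1) ≤ (1 / √((j : ℝ) + 1)) * (1 / √((l : ℝ) + 1)) := by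
    intro j l
    rw [div_mul_div_comm, one_mul, ← Real.sqrt_mul (by positivity)]
    have : √(((j : ℝ) + 1) * ((l : ℝ) + 1)) ≤ (j : ℝ) + l + 1 := by
      rw [Real.sqrt_le_left (by positivity)]
      nlinarith [mul_nonneg (Nat.cast_nonneg (α := ℝ) j) (Nat.cast_nonneg (α := ℝ) l), sq_nonneg ((j : ℝ) + l), Nat.cast_nonneg (α := ℝ) j, Nat.cast_nonneg (α := ℝ) l]
    gcongr
  calc _ ≤ ∑ j ∈ Finset.range (i + 1), ∑ l ∈ Finset.range N,
        (1 / √((j : ℝ) + 1)) * (1 / √((l : ℝ) + 1)) :=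
        Finset.sum_le_sum fun j _ => Finset.sum_le_sum fun l _ => h j l
    _ = (∑ j ∈ Finset.range (i + 1), 1 / √((j : ℝ) + 1)) * ∑ l ∈ Finset.range N, 1 / √((l : ℝ) + 1) := by
        rw [Finset.sum_mul_sum]
    _ ≤ (2 * √((i + 1 : ℕ) : ℝ)) * (2 * √(N : ℝ)) := by
        gcongr
        · exact sum_inv_sqrt_le _
        · exact sum_inv_sqrt_le _
    _ ≤ (2 * √((i + 1 : ℕ) : ℝ)) * (2 * (2 * √((i + 1 : ℕ) : ℝ))) := by
        gcongr
        rw [Real.sqrt_le_left (by positivity), mul_pow, Real.sq_sqrt (by positivity)]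
        have : (N : ℝ) ≤ 2 * ((i + 1 : ℕ) : ℝ) := by exact_mod_cast hN
        have h0 : (0 : ℝ) ≤ ((i + 1 : ℕ) : ℝ) := by positivity
        linarith
    _ = 8 * (√((i + 1 : ℕ) : ℝ) ^ 2) := by ring
    _ = _ := by rw [Real.sq_sqrt (by positivity)]; push_cast; ring

lemma tie_real (v : ℕ) : ∑ j ∈ Finset.range (v + 1), ∑ i ∈ Finset.range (v + 1),
    ∑ l ∈ Finset.range (v + 1), ∑ i' ∈ Finset.range (v + 1),
      (if j + i = l + i' then (1 / (((j + i : ℕ) : ℝ) + 1) ^ 2) * (1 / (((l + i' : ℕ) : ℝ) + 1) ^ 2) else 0)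
      ≤ 2 * Hs v := by
  have h1 : ∀ j i l : ℕ, ∑ i' ∈ Finset.range (v + 1),
      (if j + i = l + i' then (1 / (((j + i : ℕ) : ℝ) + 1) ^ 2) * (1 / (((l + i' : ℕ) : ℝ) + 1) ^ 2) else 0)
      ≤ if l ∈ Finset.range (j + i + 1) then 1 / ((j : ℝ) + i + 1) ^ 4 else 0 := by
    intro j i l
    split_ifs with h
    · rw [Finset.mem_range] at h
      calc _ ≤ ∑ i' ∈ Finset.range (v + 1), (if i' = j + i - l then 1 / ((j : ℝ) + i + 1) ^ 4 else 0) := by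
            refine Finset.sum_le_sum fun i' _ => ?_
            split_ifs with h1 h2 h2
            · rw [← h1]; push_cast; apply le_of_eq; field_simp
            · omega
            · positivity
            · exact le_rfl
        _ ≤ _ := by
            rw [Finset.sum_ite_eq']; split_ifs
            · exact le_rfl
            · positivity
    · apply le_of_eq
      refine Finset.sum_eq_zero fun i' _ => ?_
      rw [Finset.mem_range] at h
      rw [if_neg (by omega)]
  have h2 : ∀ j i : ℕ, ∑ l ∈ Finset.range (v + 1), (if l ∈ Finset.range (j + i + 1) then 1 / ((j : ℝ) + i + 1) ^ 4 else 0)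
      ≤ (1 / ((j : ℝ) + 1)) * (1 / (0 + (i : ℝ) + 1) ^ 2) := by
    intro j i
    calc _ ≤ ∑ l ∈ Finset.range (j + i + 1), 1 / ((j : ℝ) + i + 1) ^ 4 := by
          rw [← Finset.sum_filter]
          refine Finset.sum_le_sum_of_subset_of_nonneg (fun l hl => (Finset.mem_filter.1 hl).2) ?_
          intros; positivity
      _ = 1 / ((j : ℝ) + i + 1) ^ 3 := by
          rw [Finset.sum_const, Finset.card_range, nsmul_eq_mul]; push_cast; field_simp
      _ ≤ _ := by
          rw [div_mul_div_comm, one_mul]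
          gcongr
          have hi : (0 : ℝ) ≤ i := by positivity
          have hj : (0 : ℝ) ≤ j := by positivity
          calc ((j : ℝ) + 1) * (0 + i + 1) ^ 2 ≤ ((j : ℝ) + i + 1) * (j + i + 1) ^ 2 := by
                gcongr <;> linarith
            _ = _ := by ring
  calc _ ≤ ∑ j ∈ Finset.range (v + 1), ∑ i ∈ Finset.range (v + 1),
        (1 / ((j : ℝ) + 1)) * (1 / (0 + (i : ℝ) + 1) ^ 2) :=
        Finset.sum_le_sum fun j _ => Finset.sum_le_sum fun i _ =>
          (Finset.sum_le_sum fun l _ => h1 j i l).trans (h2 j i)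
    _ = Hs v * ∑ i ∈ Finset.range (v + 1), (1 / (0 + (i : ℝ) + 1) ^ 2) := by rw [Hs, Finset.sum_mul_sum]
    _ ≤ Hs v * (2 / (0 + 1)) := by
        have := Hs_ge_one v
        gcongr
        exact sum_inv_sq_le' 0 le_rfl _
    _ = _ := by ring

lemma off_real (v : ℕ) : ∑ j ∈ Finset.range (v + 1), ∑ i ∈ Finset.range (v + 1),
    ∑ l ∈ Finset.range (v + 1), ∑ i' ∈ Finset.range (v + 1),
      (if j ≤ i ∧ l + i' < j + i then (1 / ((i : ℝ) + 1) ^ 2) * (1 / (((j + (l + i') : ℕ) : ℝ) + 1) ^ 2) else 0)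
      ≤ 16 * Hs v := by
  rw [Finset.sum_comm, Hs, Finset.mul_sum]
  refine Finset.sum_le_sum fun i _ => ?_
  have h1 : ∀ j l : ℕ, ∑ i' ∈ Finset.range (v + 1),
      (if j ≤ i ∧ l + i' < j + i then (1 / ((i : ℝ) + 1) ^ 2) * (1 / (((j + (l + i') : ℕ) : ℝ) + 1) ^ 2) else 0)
      ≤ if j ∈ Finset.range (i + 1) then (if l ∈ Finset.range (2 * (i + 1)) then
        (1 / ((i : ℝ) + 1) ^ 2) * (2 * (1 / ((j : ℝ) + l + 1))) else 0) else 0 := by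
    intro j l
    by_cases hj : j ≤ i
    swap
    · rw [if_neg (by simpa using hj)]
      apply le_of_eq
      exact Finset.sum_eq_zero fun i' _ => by rw [if_neg (by tauto)]
    by_cases hl : l ∈ Finset.range (2 * (i + 1))
    swap
    · rw [Finset.mem_range] at hl
      rw [if_pos (by simpa [Nat.lt_succ_iff] using hj), if_neg (by simpa using hl)]
      apply le_of_eq
      exact Finset.sum_eq_zero fun i' _ => by rw [if_neg (by omega)]
    rw [if_pos (by simpa [Nat.lt_succ_iff] using hj), if_pos hl]
    calc _ ≤ ∑ i' ∈ Finset.range (v + 1), (1 / ((i : ℝ) + 1) ^ 2) * (1 / (((j : ℝ) + l) + i' + 1) ^ 2) := by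
          refine Finset.sum_le_sum fun i' _ => ?_
          split_ifs
          · apply le_of_eq; push_cast; congr 3; ring
          · positivity
      _ ≤ _ := by
          rw [← Finset.mul_sum]
          gcongr
          rw [mul_one_div]
          exact sum_inv_sq_le' _ (by positivity) _
  calc _ ≤ ∑ j ∈ Finset.range (v + 1), ∑ l ∈ Finset.range (v + 1),
        if j ∈ Finset.range (i + 1) then (if l ∈ Finset.range (2 * (i + 1)) then
        (1 / ((i : ℝ) + 1) ^ 2) * (2 * (1 / ((j : ℝ) + l + 1))) else 0) else 0 :=
        Finset.sum_le_sum fun j _ => Finset.sum_le_sum fun l _ => h1 j l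
    _ ≤ ∑ j ∈ Finset.range (v + 1), if j ∈ Finset.range (i + 1) then ∑ l ∈ Finset.range (2 * (i + 1)),
        (1 / ((i : ℝ) + 1) ^ 2) * (2 * (1 / ((j : ℝ) + l + 1))) else 0 := by
        refine Finset.sum_le_sum fun j _ => ?_
        split_ifs
        · rw [← Finset.sum_filter]
          refine Finset.sum_le_sum_of_subset_of_nonneg (fun l hl => (Finset.mem_filter.1 hl).2) ?_
          intros; positivity
        · simp
    _ ≤ ∑ j ∈ Finset.range (i + 1), ∑ l ∈ Finset.range (2 * (i + 1)),
        (1 / ((i : ℝ) + 1) ^ 2) * (2 * (1 / ((j : ℝ) + l + 1))) := by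
        rw [← Finset.sum_filter]
        refine Finset.sum_le_sum_of_subset_of_nonneg (fun l hl => (Finset.mem_filter.1 hl).2) ?_
        intros; positivity
    _ = (1 / ((i : ℝ) + 1) ^ 2) * (2 * ∑ j ∈ Finset.range (i + 1), ∑ l ∈ Finset.range (2 * (i + 1)),
         1 / ((j : ℝ) + l + 1)) := by simp_rw [← Finset.mul_sum]
    _ ≤ (1 / ((i : ℝ) + 1) ^ 2) * (2 * (8 * ((i : ℝ) + 1))) := by
        gcongr
        exact sum2_le i _ le_rfl
    _ = _ := by field_simp; ring

lemma mm_real (v : ℕ) : Hs v / 4 ≤ ∑ j ∈ Finset.range (v + 1), ∑ i ∈ Finset.range (v + 1),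
    1 / (((j + i : ℕ) : ℝ) + 1) ^ 2 := by
  rw [Hs, Finset.sum_div]
  refine Finset.sum_le_sum fun j hj => ?_
  calc _ = ∑ i ∈ Finset.range (j + 1), 1 / (2 * ((j : ℝ) + 1)) ^ 2 := by
        rw [Finset.sum_const, Finset.card_range, nsmul_eq_mul]; push_cast; field_simp; norm_num
    _ ≤ ∑ i ∈ Finset.range (j + 1), 1 / (((j + i : ℕ) : ℝ) + 1) ^ 2 := by
        refine Finset.sum_le_sum fun i hi => ?_
        rw [Finset.mem_range, Nat.lt_succ_iff] at hi
        have : (i : ℝ) ≤ j := by exact_mod_cast hi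
        gcongr
        push_cast; linarith
    _ ≤ _ := by
        refine Finset.sum_le_sum_of_subset_of_nonneg (Finset.range_subset_range.2 ?_) ?_
        · rw [Finset.mem_range] at hj; omega
        · intros; positivity

lemma ofReal_sum4 (R : Finset ℕ) (f : ℕ → ℕ → ℕ → ℕ → ℝ) (hf : ∀ j i l i', 0 ≤ f j i l i') :
    ∑ j ∈ R, ∑ i ∈ R, ∑ l ∈ R, ∑ i' ∈ R, ENNReal.ofReal (f j i l i') =
      ENNReal.ofReal (∑ j ∈ R, ∑ i ∈ R, ∑ l ∈ R, ∑ i' ∈ R, f j i l i') := by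
  rw [ENNReal.ofReal_sum_of_nonneg]
  · refine Finset.sum_congr rfl fun j _ => ?_
    rw [ENNReal.ofReal_sum_of_nonneg]
    · refine Finset.sum_congr rfl fun i _ => ?_
      rw [ENNReal.ofReal_sum_of_nonneg]
      · refine Finset.sum_congr rfl fun l _ => ?_
        rw [ENNReal.ofReal_sum_of_nonneg]
        exact fun i' _ => hf _ _ _ _
      · exact fun l _ => Finset.sum_nonneg fun _ _ => hf _ _ _ _
    · exact fun l _ => Finset.sum_nonneg fun _ _ => Finset.sum_nonneg fun _ _ => hf _ _ _ _
  · exact fun l _ => Finset.sum_nonneg fun _ _ => Finset.sum_nonneg fun _ _ =>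
      Finset.sum_nonneg fun _ _ => hf _ _ _ _

lemma uE_bounds : ∃ C c : ℝ, 0 < C ∧ 0 < c ∧ ∀ t : ℕ,
    uE 4 t ≤ ENNReal.ofReal (C * (1 / ((t : ℝ) + 1) ^ 2)) ∧
    ENNReal.ofReal (c * (1 / ((t : ℝ) + 1) ^ 2)) ≤ uE 4 t := by
  obtain ⟨C, hC, h1⟩ := pR_upper 4 (by norm_num)
  obtain ⟨c, hc, h2⟩ := pR_lower 4 (by norm_num)
  have e : ∀ x : ℝ, 0 ≤ x → √x ^ 4 = x ^ 2 := fun x hx => by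
    rw [show 4 = 2 * 2 by norm_num, pow_mul, Real.sq_sqrt hx]
  refine ⟨C, c, hC, hc, fun t => ⟨?_, ?_⟩⟩
  · rw [uE, pE_eq (by norm_num)]
    refine ENNReal.ofReal_le_ofReal ((h1 _ _).trans ?_)
    rw [e _ (by positivity), mul_one_div]
    gcongr
    push_cast
    have : (0 : ℝ) ≤ t := by positivity
    linarith
  · rw [uE, pE_eq (by norm_num)]
    refine ENNReal.ofReal_le_ofReal (le_trans ?_ (h2 t))
    rw [e _ (by positivity), mul_one_div]

lemma W_bound : ∃ C c : ℝ, 0 < C ∧ 0 < c ∧ ∀ v, tieS 4 v + 4 * offS 4 v ≤ ENNReal.ofReal (C * Hs v) ∧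
    ENNReal.ofReal (c * Hs v) ≤ mm 4 v ∧ mm 4 v ≠ ⊤ := by
  obtain ⟨C, c, hC, hc, hu⟩ := uE_bounds
  refine ⟨C ^ 2 * 66, c / 4, by positivity, by positivity, fun v => ?_⟩
  have hH := Hs_ge_one v
  set U : ℕ → ℝ := fun t => 1 / ((t : ℝ) + 1) ^ 2 with hU
  have hU0 : ∀ t, 0 ≤ U t := fun t => by rw [hU]; positivity
  have hmul : ∀ s t, uE 4 s * uE 4 t ≤ ENNReal.ofReal (C ^ 2 * (U s * U t)) := by
    intro s t
    refine (mul_le_mul' (hu s).1 (hu t).1).trans ?_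
    rw [← ENNReal.ofReal_mul (by positivity)]
    apply le_of_eq; congr 1; ring
  have ht : tieS 4 v ≤ ENNReal.ofReal (C ^ 2 * (2 * Hs v)) := by
    refine le_trans ?_ (ENNReal.ofReal_le_ofReal (mul_le_mul_of_nonneg_left (tie_real v) (sq_nonneg C)))
    simp_rw [Finset.mul_sum]
    rw [← ofReal_sum4]
    · unfold tieS
      gcongr with j _ i _ l _ i' _
      split_ifs
      · exact hmul _ _
      · simp
    · intros; positivity
  have ho : offS 4 v ≤ ENNReal.ofReal (C ^ 2 * (16 * Hs v)) := by
    refine le_trans ?_ (ENNReal.ofReal_le_ofReal (mul_le_mul_of_nonneg_left (off_real v) (sq_nonneg C)))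
    simp_rw [Finset.mul_sum]
    rw [← ofReal_sum4]
    · unfold offS
      gcongr with j _ i _ l _ i' _
      split_ifs
      · exact hmul _ _
      · simp
    · intros; positivity
  refine ⟨?_, ?_, ?_⟩
  · calc _ ≤ ENNReal.ofReal (C ^ 2 * (2 * Hs v)) + ENNReal.ofReal 4 * ENNReal.ofReal (C ^ 2 * (16 * Hs v)) := by
          gcongr
          simp
      _ = _ := by
          rw [← ENNReal.ofReal_mul (by norm_num), ← ENNReal.ofReal_add (by positivity) (by positivity)]
          congr 1; ring
  · calc ENNReal.ofReal (c / 4 * Hs v) ≤ ENNReal.ofReal (c * ∑ j ∈ Finset.range (v + 1), ∑ i ∈ Finset.range (v + 1),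
        1 / (((j + i : ℕ) : ℝ) + 1) ^ 2) := by
          refine ENNReal.ofReal_le_ofReal ?_
          have := mul_le_mul_of_nonneg_left (mm_real v) hc.le
          linarith
      _ = ∑ j ∈ Finset.range (v + 1), ∑ i ∈ Finset.range (v + 1), ENNReal.ofReal (c * (1 / (((j + i : ℕ) : ℝ) + 1) ^ 2)) := by
          simp_rw [Finset.mul_sum]
          rw [ENNReal.ofReal_sum_of_nonneg (fun j _ => Finset.sum_nonneg fun _ _ => by positivity)]
          refine Finset.sum_congr rfl fun j _ => ?_
          rw [ENNReal.ofReal_sum_of_nonneg (fun _ _ => by positivity)]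
      _ ≤ _ := by
          unfold mm
          gcongr with j _ i _
          exact (hu _).2
  · unfold mm
    refine (ENNReal.sum_lt_top.2 fun j _ => ENNReal.sum_lt_top.2 fun i _ => ?_).ne
    exact (hu _).1.trans_lt ENNReal.ofReal_lt_top

lemma cheb_pt (m : ℝ) (hm : 0 ≤ m) (L : ℝ≥0∞) :
    2 * (ENNReal.ofReal m * L) + ENNReal.ofReal (m ^ 2 / 4) * (if L < ENNReal.ofReal m / 2 then 1 else 0)
      ≤ ENNReal.ofReal m * ENNReal.ofReal m + L * L := by
  by_cases hL : L = ⊤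
  · rw [hL]; simp
  obtain ⟨l, hl, rfl⟩ : ∃ l : ℝ, 0 ≤ l ∧ L = ENNReal.ofReal l :=
    ⟨L.toReal, ENNReal.toReal_nonneg, (ENNReal.ofReal_toReal hL).symm⟩
  have e2 : (2 : ℝ≥0∞) = ENNReal.ofReal 2 := by simp
  rw [e2, ← ENNReal.ofReal_div_of_pos (by norm_num)]
  split_ifs with h
  · have hlm : l < m / 2 := by
      by_contra hc
      exact absurd h (not_lt.2 (ENNReal.ofReal_le_ofReal (not_lt.1 hc)))
    rw [mul_one, ← ENNReal.ofReal_mul hm, ← ENNReal.ofReal_mul (by norm_num), ← ENNReal.ofReal_add (by positivity) (by positivity),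
      ← ENNReal.ofReal_mul hm, ← ENNReal.ofReal_mul hl, ← ENNReal.ofReal_add (by positivity) (by positivity)]
    refine ENNReal.ofReal_le_ofReal ?_
    nlinarith
  · rw [mul_zero, add_zero, ← ENNReal.ofReal_mul hm, ← ENNReal.ofReal_mul (by norm_num),
      ← ENNReal.ofReal_mul hm, ← ENNReal.ofReal_mul hl, ← ENNReal.ofReal_add (by positivity) (by positivity)]
    refine ENNReal.ofReal_le_ofReal ?_
    nlinarith [sq_nonneg (m - l)]

theorem var_final : ∃ C : ℝ, 0 < C ∧ ∀ v : ℕ, ∃ (B : (ℕ → Zd 4) → Prop) (κ : ℝ≥0∞),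
    Dep (2 * v) B ∧
    (∀ η : ℕ → Zd 4, ¬ B η → 1 ≤ κ * ∑ j ∈ Finset.range (2 * v + 1),
      ∑ i ∈ Finset.range (2 * v + 1), pE i (η 0 - η j)) ∧
    κ ≤ 2 ∧ ∀ y, EE (2 * v) y (fun ω => κ + if B ω then 1 else 0) ≤ ENNReal.ofReal (C / Hs v) := by
  obtain ⟨C, c, hC, hc, hW⟩ := W_bound
  have hd : 0 < 4 := by norm_num
  refine ⟨2 / c + 4 * C / c ^ 2, by positivity, fun v => ?_⟩
  obtain ⟨hW1, hW2, hW3⟩ := hW v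
  have hH := Hs_ge_one v
  obtain ⟨m, hm0, hm⟩ : ∃ m : ℝ, 0 ≤ m ∧ mm 4 v = ENNReal.ofReal m :=
    ⟨(mm 4 v).toReal, ENNReal.toReal_nonneg, (ENNReal.ofReal_toReal hW3).symm⟩
  have hm1 : 1 ≤ m := by
    have : (1 : ℝ≥0∞) ≤ mm 4 v := by
      unfold mm
      refine le_trans ?_ (Finset.single_le_sum (fun _ _ => zero_le) (Finset.mem_range.2 (Nat.succ_pos v)))
      refine le_trans ?_ (Finset.single_le_sum (fun _ _ => zero_le) (Finset.mem_range.2 (Nat.succ_pos v)))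
      simp [uE, pE]
    rw [hm] at this
    simpa using this
  have hmc : c * Hs v ≤ m := by
    rw [hm] at hW2
    exact (ENNReal.ofReal_le_ofReal_iff hm0).1 hW2
  have hκ : ∀ L : ℝ≥0∞, ENNReal.ofReal m / 2 ≤ L → 1 ≤ ENNReal.ofReal (2 / m) * L := by
    intro L hL
    refine le_trans ?_ (mul_le_mul' le_rfl hL)
    rw [show (2 : ℝ≥0∞) = ENNReal.ofReal 2 by simp, ← ENNReal.ofReal_div_of_pos (by norm_num),
      ← ENNReal.ofReal_mul (by positivity)]
    rw [show 2 / m * (m / 2) = 1 by field_simp]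
    simp
  refine ⟨fun η => LL v η < ENNReal.ofReal m / 2, ENNReal.ofReal (2 / m), ?_, ?_, ?_, ?_⟩
  · intro ω ω' h
    have : LL v ω = LL v ω' := by
      unfold LL
      refine Finset.sum_congr rfl fun j hj => Finset.sum_congr rfl fun i _ => ?_
      rw [Finset.mem_range] at hj
      rw [h 0 (by omega), h (2 * j) (by omega)]
    simp only [this]
  · intro η hη
    refine (hκ _ (not_lt.1 hη)).trans ?_
    refine mul_le_mul' le_rfl ?_
    unfold LL
    have hinj : Set.InjOn (fun j : ℕ => 2 * j) (Finset.range (v + 1)) := fun a _ b _ h => by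
      simp only at h; omega
    have e1 : ∀ j, ∑ i ∈ Finset.range (v + 1), pE (2 * i) (η 0 - η (2 * j)) ≤
        ∑ i ∈ Finset.range (2 * v + 1), pE i (η 0 - η (2 * j)) := by
      intro j
      rw [← Finset.sum_image (g := fun j : ℕ => 2 * j) (f := fun i => pE i (η 0 - η (2 * j))) hinj]
      refine Finset.sum_le_sum_of_subset fun g hg => ?_
      simp only [Finset.mem_image, Finset.mem_range] at hg ⊢
      omega
    refine (Finset.sum_le_sum fun j _ => e1 j).trans ?_
    rw [← Finset.sum_image (g := fun j : ℕ => 2 * j) (f := fun j => ∑ i ∈ Finset.range (2 * v + 1), pE i (η 0 - η j)) hinj]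
    refine Finset.sum_le_sum_of_subset fun g hg => ?_
    simp only [Finset.mem_image, Finset.mem_range] at hg ⊢
    omega
  · rw [show (2 : ℝ≥0∞) = ENNReal.ofReal 2 by simp]
    refine ENNReal.ofReal_le_ofReal ?_
    rw [div_le_iff₀ (by linarith)]; linarith
  · intro y
    rw [EE_add, EE_const hd]
    set p := EE (2 * v) y (fun ω => if LL v ω < ENNReal.ofReal m / 2 then (1 : ℝ≥0∞) else 0) with hp
    have hp1 : p ≤ 1 := by
      refine (EE_mono (g := fun _ => 1) _ _ fun ω => by split_ifs <;> simp).trans ?_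
      rw [EE_const hd]
    have h1 := EE_mono (2 * v) y (fun ω => cheb_pt m hm0 (LL v ω))
    rw [EE_add, EE_add, EE_const_mul, EE_const_mul, EE_const_mul, EE_const hd, EE_LL hd, ← hp, hm] at h1
    have h2 := second_moment hd v y
    rw [hm] at h2
    have h3 := h1.trans (add_le_add le_rfl (h2.trans (add_le_add le_rfl hW1)))
    obtain ⟨q, hq0, hq⟩ : ∃ q : ℝ, 0 ≤ q ∧ p = ENNReal.ofReal q :=
      ⟨p.toReal, ENNReal.toReal_nonneg, (ENNReal.ofReal_toReal (hp1.trans_lt ENNReal.one_lt_top).ne).symm⟩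
    rw [hq, show (2 : ℝ≥0∞) = ENNReal.ofReal 2 by simp, ← ENNReal.ofReal_mul hm0,
      ← ENNReal.ofReal_mul (by norm_num), ← ENNReal.ofReal_mul (by positivity),
      ← ENNReal.ofReal_add (by positivity) (by positivity),
      ← ENNReal.ofReal_add (by positivity) (by positivity),
      ← ENNReal.ofReal_add (by positivity) (by positivity),
      ENNReal.ofReal_le_ofReal_iff (by positivity)] at h3
    have h4 : m ^ 2 * q ≤ 4 * C * Hs v := by nlinarith
    have hcH : 0 < c * Hs v := by positivity
    have h5 : q ≤ 4 * C / c ^ 2 / Hs v := by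
      rw [div_div, le_div_iff₀ (by positivity)]
      have : (c * Hs v) ^ 2 * q ≤ 4 * C * Hs v := by
        refine le_trans ?_ h4
        gcongr
      have h6 : (q * (c ^ 2 * Hs v)) * Hs v ≤ (4 * C) * Hs v := by nlinarith
      exact le_of_mul_le_mul_right h6 (by linarith)
    suffices hfin : ENNReal.ofReal (2 / m) + p ≤ ENNReal.ofReal ((2 / c + 4 * C / c ^ 2) / Hs v) by
      convert hfin
    rw [hq, ← ENNReal.ofReal_add (by positivity) hq0]
    refine ENNReal.ofReal_le_ofReal ?_
    rw [add_div]
    refine add_le_add ?_ h5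
    rw [div_div]
    gcongr

lemma one_div_le_log (x : ℝ) (hx : 0 < x) : 1 / (x + 1) ≤ Real.log (x + 1) - Real.log x := by
  rw [← Real.log_div (by linarith) hx.ne']
  have h := Real.one_sub_inv_le_log_of_pos (x := (x + 1) / x) (by positivity)
  refine le_trans (le_of_eq ?_) h
  field_simp
  ring

lemma sum_harm_le (a : ℝ) (ha : 0 < a) (K : ℕ) :
    ∑ g ∈ Finset.range K, 1 / (a + g + 1) ≤ Real.log (a + K) - Real.log a := by
  induction K with
  | zero => simp
  | succ K ih =>
    rw [Finset.sum_range_succ]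
    have h := one_div_le_log (a + K) (by positivity)
    have e : a + ((K + 1 : ℕ) : ℝ) = a + K + 1 := by push_cast; ring
    rw [e]; linarith

lemma Hs_ge_log' (v : ℕ) : Real.log ((v : ℝ) + 2) ≤ Hs v := by
  unfold Hs
  induction v with
  | zero =>
    have := Real.log_le_sub_one_of_pos (x := 2) (by norm_num)
    simp; linarith
  | succ v ih =>
    rw [Finset.sum_range_succ]
    refine le_trans ?_ (add_le_add ih le_rfl)
    have hv : (0 : ℝ) ≤ v := by positivity
    have h := Real.log_le_sub_one_of_pos (x := ((v : ℝ) + 1 + 2) / (v + 2)) (by positivity)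
    rw [Real.log_div (by positivity) (by positivity)] at h
    have h3 : ((v : ℝ) + 1 + 2) / (v + 2) - 1 = 1 / (v + 1 + 1) := by field_simp; ring
    push_cast
    linarith

lemma Hs_ge_log (v : ℕ) : Real.log ((v : ℝ) + 1) ≤ Hs v :=
  (Real.log_le_log (by positivity) (by linarith)).trans (Hs_ge_log' v)

lemma tsum_phi_le (β : ℝ) (hβ : 0 ≤ β) (m0 g : ℕ) :
    ∑' b : ℕ, ENNReal.ofReal (β / (((m0 + b + g : ℕ) : ℝ) + 1) ^ 2) ≤
      ENNReal.ofReal (2 * β / ((m0 : ℝ) + g + 1)) := by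
  rw [ENNReal.tsum_eq_iSup_nat]
  refine iSup_le fun N => ?_
  rw [← ENNReal.ofReal_sum_of_nonneg (fun _ _ => by positivity)]
  refine ENNReal.ofReal_le_ofReal ?_
  have h := sum_inv_sq_le' ((m0 : ℝ) + g) (by positivity) N
  calc _ = β * ∑ b ∈ Finset.range N, 1 / ((m0 : ℝ) + g + b + 1) ^ 2 := by
        rw [Finset.mul_sum]
        refine Finset.sum_congr rfl fun b _ => ?_
        rw [mul_one_div]; push_cast; congr 3; ring
    _ ≤ β * (2 / ((m0 : ℝ) + g + 1)) := by gcongr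
    _ = _ := by ring

theorem real_bound {d : ℕ} (hd : 0 < d) (B : (ℕ → Zd d) → Prop) (κ : ℝ≥0∞) (win : ℕ)
    (hB : Dep win B)
    (hgood : ∀ η : ℕ → Zd d, ¬ B η → 1 ≤ κ * ∑ j ∈ Finset.range (win + 1),
      ∑ i ∈ Finset.range (win + 1), pE i (η 0 - η j))
    (hκ : κ ≤ 2) (τ : ℝ) (hτ0 : 0 ≤ τ)
    (hτ : ∀ y, EE win y (fun ω => κ + if B ω then 1 else 0) ≤ ENNReal.ofReal τ)
    (T n : ℕ) (hn : 2 ≤ n) (hwn : win ≤ n) (hnT : n ≤ T) (β : ℝ) (hβ : 0 ≤ β)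
    (hpβ : ∀ t, n / 2 ≤ t → ∀ z : Zd d, pR t z ≤ β / ((t : ℝ) + 1) ^ 2) :
    EE (T + win + win) (0 : Zd d) (fun ω => Dn (rng ω T) n) ≤
      ENNReal.ofReal (6 * T * ((2 * win + 1) * 72 * β / n +
        8 * τ ^ 2 * β * Real.log (1 + 9 * T / n))) := by
  set m0 := n / 2 with hm0
  have hm1 : 1 ≤ m0 := by omega
  set φ : ℕ → ℝ≥0∞ := fun t => ENNReal.ofReal (β / ((t : ℝ) + 1) ^ 2) with hφ
  have hanti : Antitone φ := fun a b hab => by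
    simp only [hφ]
    have : (a : ℝ) ≤ b := by exact_mod_cast hab
    exact ENNReal.ofReal_le_ofReal (by gcongr)
  have hb := expect_bound hd B κ win hB hgood (ENNReal.ofReal τ) hτ 3
    (by calc κ + 1 ≤ 2 + 1 := by gcongr
          _ = 3 := by norm_num) T m0 n hm1 φ hanti
    (fun t ht z => by rw [pE_eq hd]; exact ENNReal.ofReal_le_ofReal (hpβ t ht z))
  have hPhi : ∀ g, Phi φ m0 n win g ≤ ENNReal.ofReal ((2 * n) * (2 * β / ((m0 : ℝ) + g + 1))) := by
    intro g
    unfold Phi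
    rw [ENNReal.ofReal_mul (by positivity)]
    refine mul_le_mul' ?_ (tsum_phi_le β hβ m0 g)
    rw [show (2 * n : ℝ) = ((2 * n : ℕ) : ℝ) by push_cast; ring, ENNReal.ofReal_natCast]
    exact_mod_cast (by omega : n + win + 1 - m0 ≤ 2 * n)
  have hnR : (2 : ℝ) ≤ n := by exact_mod_cast hn
  have hTR : (n : ℝ) ≤ T := by exact_mod_cast hnT
  have hm2 : (n : ℝ) / 2 ≤ (m0 : ℝ) + 1 := by
    have : n ≤ 2 * (m0 + 1) := by omega
    have : (n : ℝ) ≤ 2 * (m0 + 1) := by exact_mod_cast this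
    linarith
  have hm3 : (n : ℝ) / 3 ≤ (m0 : ℝ) := by
    have : n ≤ 3 * m0 := by omega
    have : (n : ℝ) ≤ 3 * m0 := by exact_mod_cast this
    linarith
  have hmpos : (0 : ℝ) < m0 := by linarith
  have hlog : ∑ g ∈ Finset.range (T + win + 1), 1 / ((m0 : ℝ) + g + 1) ≤ Real.log (1 + 9 * T / n) := by
    refine (sum_harm_le _ hmpos _).trans ?_
    rw [← Real.log_div (by positivity) (by positivity)]
    refine Real.log_le_log (by positivity) ?_
    rw [add_div, div_self hmpos.ne']
    gcongr 1 + ?_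
    have h3 : ((T + win + 1 : ℕ) : ℝ) ≤ 3 * T := by
      exact_mod_cast (by omega : T + win + 1 ≤ 3 * T)
    calc _ ≤ 3 * (T : ℝ) / (n / 3) := by gcongr
      _ = _ := by field_simp; ring
  have hmain : ENNReal.ofReal (n / 2) * EE (T + win + win) (0 : Zd d) (fun ω => Dn (rng ω T) n) ≤
      ENNReal.ofReal (3 * T * ((2 * win + 1) * (9 * ((2 * n) * (2 * β / (n / 2)))) +
        2 * (τ ^ 2 * ((2 * n) * (2 * β * Real.log (1 + 9 * T / n)))))) := by
    have hlog0 : 0 ≤ Real.log (1 + 9 * T / n) := Real.log_nonneg (by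
      have : (0 : ℝ) ≤ 9 * T / n := by positivity
      linarith)
    refine le_trans (mul_le_mul' ?_ le_rfl) (hb.trans ?_)
    · rw [← ENNReal.ofReal_natCast]
      refine ENNReal.ofReal_le_ofReal ?_
      have : n ≤ 2 * (n + 1 - m0) := by omega
      have : (n : ℝ) ≤ 2 * ((n + 1 - m0 : ℕ) : ℝ) := by exact_mod_cast this
      linarith
    rw [ENNReal.ofReal_mul (by positivity)]
    refine mul_le_mul' ?_ ?_
    · rw [← ENNReal.ofReal_natCast]
      refine ENNReal.ofReal_le_ofReal ?_
      exact_mod_cast (by omega : T + win + 1 ≤ 3 * T)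
    rw [ENNReal.ofReal_add (by positivity) (by positivity)]
    refine add_le_add ?_ ?_
    · rw [ENNReal.ofReal_mul (by positivity), ENNReal.ofReal_mul (by positivity)]
      refine mul_le_mul' ?_ (mul_le_mul' ?_ ?_)
      · rw [← ENNReal.ofReal_natCast]
        refine ENNReal.ofReal_le_ofReal (le_of_eq ?_)
        push_cast; ring
      · norm_num
      · refine (hPhi 0).trans (ENNReal.ofReal_le_ofReal ?_)
        have : (n : ℝ) / 2 ≤ (m0 : ℝ) + ((0 : ℕ) : ℝ) + 1 := by simpa using hm2
        gcongr
    · rw [ENNReal.ofReal_mul (by norm_num)]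
      refine mul_le_mul' (by simp) ?_
      calc _ ≤ ∑ g ∈ Finset.range (T + win + 1), ENNReal.ofReal (τ ^ 2 * ((2 * n) * (2 * β / ((m0 : ℝ) + g + 1)))) := by
            refine Finset.sum_le_sum fun g _ => ?_
            rw [ENNReal.ofReal_mul (by positivity), pow_two, ENNReal.ofReal_mul hτ0]
            exact mul_le_mul' le_rfl (hPhi g)
        _ = ENNReal.ofReal (∑ g ∈ Finset.range (T + win + 1), (τ ^ 2 * ((2 * n) * (2 * β / ((m0 : ℝ) + g + 1))))) := by
            rw [ENNReal.ofReal_sum_of_nonneg (fun _ _ => by positivity)]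
        _ ≤ _ := by
            refine ENNReal.ofReal_le_ofReal ?_
            calc _ = τ ^ 2 * ((2 * n) * (2 * β * ∑ g ∈ Finset.range (T + win + 1), 1 / ((m0 : ℝ) + g + 1))) := by
                  simp only [Finset.mul_sum]
                  refine Finset.sum_congr rfl fun g _ => ?_
                  ring
              _ ≤ _ := by gcongr
  have hn2 : (0 : ℝ) < n / 2 := by linarith
  have hne : ENNReal.ofReal (n / 2) ≠ 0 := by simpa using hn2
  rw [← ENNReal.mul_le_mul_iff_right hne ENNReal.ofReal_ne_top]
  refine hmain.trans (le_of_eq ?_)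
  rw [← ENNReal.ofReal_mul hn2.le]
  congr 1
  have : (n : ℝ) ≠ 0 := by positivity
  field_simp
  ring

lemma ev_logpow (c : ℝ) (k : ℕ) : ∀ᶠ R : ℝ in atTop, c * Real.log R ^ k ≤ R := by
  have h := (Real.isLittleO_pow_log_id_atTop (n := k)).const_mul_left c
  filter_upwards [h.bound one_pos, eventually_ge_atTop 0] with R hR h0
  simp only [id, one_mul, Real.norm_eq_abs, abs_of_nonneg h0] at hR
  exact (le_abs_self _).trans hR

lemma ev_loglog (c : ℝ) (hc : 0 < c) : ∀ᶠ L : ℝ in atTop, Real.log (1 + c * L ^ 10) ≤ √L := by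
  have h := (isLittleO_log_rpow_atTop (r := 1 / 2) (by norm_num)).const_mul_left 11
  filter_upwards [h.bound one_pos, eventually_ge_atTop (1 + c), eventually_ge_atTop 1] with L hL h1 h2
  rw [one_mul, Real.norm_eq_abs, Real.norm_eq_abs, ← Real.sqrt_eq_rpow, abs_of_nonneg (Real.sqrt_nonneg _)] at hL
  refine le_trans ?_ ((le_abs_self _).trans hL)
  have : Real.log (L ^ 11) = 11 * Real.log L := by simp
  rw [← this]
  refine Real.log_le_log (by positivity) ?_
  have h3 : (1 : ℝ) ≤ L ^ 10 := one_le_pow₀ h2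
  calc 1 + c * L ^ 10 ≤ L ^ 10 + c * L ^ 10 := by linarith
    _ = (1 + c) * L ^ 10 := by ring
    _ ≤ L * L ^ 10 := by gcongr
    _ = L ^ 11 := by ring

lemma ev_all (r : ℝ) (hr : 0 < r) : ∀ᶠ T : ℕ in atTop,
    1 ≤ T ∧ 1 ≤ Real.log (r * T) ∧
    ((⌊r * T / Real.log (r * T) ^ 10⌋₊ : ℕ) : ℝ) ≤ r * T / Real.log (r * T) ^ 10 ∧
    r * T / (2 * Real.log (r * T) ^ 10) ≤ (⌊r * T / Real.log (r * T) ^ 10⌋₊ : ℕ) ∧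
    64 * Real.log (r * T) ^ 24 ≤ r * T ∧
    Real.log (1 + 18 / r * Real.log (r * T) ^ 10) ≤ √(Real.log (r * T)) ∧
    r ≤ Real.log (r * T) ∧ Real.log T / 2 ≤ Real.log (r * T) ∧ 0 < Real.log T := by
  have hR : Tendsto (fun T : ℕ => r * (T : ℝ)) atTop atTop :=
    tendsto_natCast_atTop_atTop.const_mul_atTop hr
  have hL := Real.tendsto_log_atTop.comp hR
  have hLT := Real.tendsto_log_atTop.comp (tendsto_natCast_atTop_atTop (R := ℝ))
  filter_upwards [eventually_ge_atTop 1, hL.eventually_ge_atTop 1, hR.eventually (ev_logpow 64 24),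
    hL.eventually (ev_loglog (18 / r) (by positivity)), hL.eventually_ge_atTop r,
    hLT.eventually_ge_atTop (-2 * Real.log r), hLT.eventually_gt_atTop 0] with T h1 h2 h3 h4 h5 h6 h7
  simp only [Function.comp] at h2 h4 h5 h6 h7
  have hT : (0 : ℝ) < T := by exact_mod_cast h1
  have hp : 0 < Real.log (r * T) ^ 10 := by positivity
  have hx : 0 ≤ r * T / Real.log (r * T) ^ 10 := by positivity
  refine ⟨h1, h2, Nat.floor_le hx, ?_, h3, h4, h5, ?_, h7⟩
  · have hf := Nat.lt_floor_add_one (r * T / Real.log (r * T) ^ 10)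
    have h8 : 2 ≤ r * T / Real.log (r * T) ^ 10 := by
      rw [le_div_iff₀ hp]
      refine le_trans ?_ h3
      have : Real.log (r * T) ^ 10 ≤ Real.log (r * T) ^ 24 := pow_le_pow_right₀ h2 (by norm_num)
      linarith
    have e : r * T / (2 * Real.log (r * T) ^ 10) = (r * T / Real.log (r * T) ^ 10) / 2 := by
      rw [div_div, mul_comm 2]
    rw [e]; linarith
  · rw [Real.log_mul hr.ne' hT.ne']; linarith

/-- Deterministic consequences of the choice of scale. -/
lemma scale_facts (r R L : ℝ) (hr : 0 < r) (T n : ℕ) (hT : 1 ≤ T) (hRT : R = r * T) (hL : 1 ≤ L)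
    (hn1 : (n : ℝ) ≤ R / L ^ 10) (hn2 : R / (2 * L ^ 10) ≤ n) (h64 : 64 * L ^ 24 ≤ R)
    (hll : Real.log (1 + 18 / r * L ^ 10) ≤ √L) (hrL : r ≤ L) :
    2 ≤ n ∧ n ≤ T ∧ L ^ 4 ≤ n ∧ Real.log (1 + 9 * T / n) ≤ √L ∧ 4 * √R ≤ n ∧
      L ^ 6 / √n ≤ 1 * (L ^ 11 * 2 / √R) := by
  have hTR : (0 : ℝ) < T := by exact_mod_cast hT
  have hR : 0 < R := by rw [hRT]; positivity
  have hL0 : 0 < L := by linarith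
  have hp : ∀ k : ℕ, (1 : ℝ) ≤ L ^ k := fun k => one_le_pow₀ hL
  have h4 : 32 * L ^ 14 ≤ n := by
    refine le_trans ?_ hn2
    rw [le_div_iff₀ (by positivity)]
    calc 32 * L ^ 14 * (2 * L ^ 10) = 64 * L ^ 24 := by ring
      _ ≤ R := h64
  have hn0 : (2 : ℝ) ≤ n := by linarith [hp 14]
  have hnpos : (0 : ℝ) < n := by linarith
  refine ⟨by exact_mod_cast hn0, ?_, ?_, ?_, ?_, ?_⟩
  · have : (n : ℝ) ≤ T := by
      refine hn1.trans ?_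
      rw [div_le_iff₀ (by positivity), hRT, mul_comm]
      gcongr
      refine hrL.trans ?_
      exact le_self_pow₀ hL (by norm_num)
    exact_mod_cast this
  · have : L ^ 4 ≤ L ^ 14 := pow_le_pow_right₀ hL (by norm_num)
    linarith [hp 14]
  · refine le_trans (Real.log_le_log (by positivity) ?_) hll
    gcongr 1 + ?_
    rw [div_le_iff₀ hnpos]
    calc 9 * (T : ℝ) = 18 / r * L ^ 10 * (R / (2 * L ^ 10)) := by rw [hRT]; field_simp; ring
      _ ≤ _ := by gcongr
  · refine le_trans ?_ hn2
    rw [le_div_iff₀ (by positivity)]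
    have h8 : 8 * L ^ 12 ≤ √R := Real.le_sqrt_of_sq_le (by
      calc (8 * L ^ 12) ^ 2 = 64 * L ^ 24 := by ring
        _ ≤ R := h64)
    have h9 : L ^ 10 ≤ L ^ 12 := pow_le_pow_right₀ hL (by norm_num)
    calc 4 * √R * (2 * L ^ 10) = √R * (8 * L ^ 10) := by ring
      _ ≤ √R * √R := by gcongr; linarith
      _ = R := Real.mul_self_sqrt hR.le
  · have : √R / (L ^ 5 * 2) ≤ √n := by
      refine Real.le_sqrt_of_sq_le ?_
      rw [div_pow, Real.sq_sqrt hR.le]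
      refine le_trans ?_ hn2
      gcongr
      calc 2 * L ^ 10 ≤ 4 * L ^ 10 := by linarith [hp 10]
        _ = _ := by ring
    have hs : 0 < √R := Real.sqrt_pos.2 hR
    calc L ^ 6 / √n ≤ L ^ 6 / (√R / (L ^ 5 * 2)) := by gcongr
      _ = _ := by field_simp

theorem main_four (Pw : Zd 4 → Measure (ℕ → Zd 4)) (hPw : IsSRWFamily 4 Pw)
    (r : ℝ) (hr : 0 < r) :
    ∃ C : ℝ, 0 < C ∧ ∀ᶠ T : ℕ in atTop,
      (∫ ω, (capTrunc Pw (walkRange ω 0 T) (r * T) -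
          capacity Pw (walkRange ω 0 T)) ∂ (Pw 0)) ≤
        C * (T : ℝ) / (Real.log T) ^ ((3 : ℝ) / 2) := by
  obtain ⟨β, hβ, hpR⟩ := pR_upper 4 (by norm_num)
  obtain ⟨K, hK, hvar⟩ := var_final
  set D := 6 * (216 * β + 128 * K ^ 2 * β) with hD
  have hD0 : 0 < D := by positivity
  refine ⟨D * 2 ^ ((3 : ℝ) / 2), by positivity, ?_⟩
  filter_upwards [ev_all r hr] with T ⟨hT, hL, hn1, hn2, h64, hll, hrL, hLT, hlT⟩
  set R := r * (T : ℝ) with hR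
  set L := Real.log R with hLdef
  set n := ⌊R / L ^ 10⌋₊ with hn
  obtain ⟨h2n, hnT, hn4, hlog, hsR, -⟩ := scale_facts r R L hr T n hT hR hL hn1 hn2 h64 hll hrL
  have hTR : (0 : ℝ) < T := by exact_mod_cast hT
  have hRpos : 0 < R := by positivity
  have hL0 : 0 < L := by linarith
  have hnR : (2 : ℝ) ≤ n := by exact_mod_cast h2n
  have hnpos : (0 : ℝ) < n := by linarith
  set s := Nat.sqrt n with hs
  set v := s / 2 with hv
  have hsn : s ≤ n := Nat.sqrt_le_self n
  obtain ⟨B, κ, hB, hgood, hκ, hτ⟩ := hvar v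
  have hHs := Hs_ge_one v
  have hb := real_bound (by norm_num) B κ (2 * v) hB hgood hκ (K / Hs v) (by positivity) hτ T n h2n
    (by omega) hnT β hβ.le (fun t _ z => by
      refine (hpR t z).trans (le_of_eq ?_)
      congr 1
      rw [show 4 = 2 * 2 by norm_num, pow_mul, Real.sq_sqrt (by positivity)])
  have hHL : L / 4 ≤ Hs v := by
    refine le_trans ?_ (Hs_ge_log v)
    have h1 : √(n : ℝ) / 2 ≤ (v : ℝ) + 1 := by
      have hsq : √(n : ℝ) ≤ s + 1 := by
        rw [Real.sqrt_le_left (by positivity)]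
        have := (Nat.lt_succ_sqrt' n).le
        exact_mod_cast this
      have h3 : s + 1 ≤ 2 * (v + 1) := by omega
      have h3 : (s : ℝ) + 1 ≤ 2 * (v + 1) := by exact_mod_cast h3
      linarith
    have h4 : √(√R) ≤ √(n : ℝ) / 2 := by
      have : √(4 * √R) ≤ √(n : ℝ) := Real.sqrt_le_sqrt hsR
      rw [Real.sqrt_mul (by norm_num), show √(4 : ℝ) = 2 by
        rw [show (4 : ℝ) = 2 ^ 2 by norm_num]; simp] at this
      linarith
    have h5 : Real.log √(√R) = L / 4 := by
      rw [Real.log_sqrt (by positivity), Real.log_sqrt hRpos.le]; ring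
    rw [← h5]
    exact Real.log_le_log (by positivity) (h4.trans h1)
  have hlog0 : 0 ≤ Real.log (1 + 9 * T / n) := Real.log_nonneg (by
    have : (0 : ℝ) ≤ 9 * T / n := by positivity
    linarith)
  set P := L ^ ((3 : ℝ) / 2) with hP
  have hP0 : 0 < P := by positivity
  have hPL : P = L * √L := by
    rw [hP, show (3 : ℝ) / 2 = 1 + 1 / 2 by norm_num, Real.rpow_add hL0, Real.rpow_one, Real.sqrt_eq_rpow]
  have hsL : √L * √L = L := Real.mul_self_sqrt hL0.le
  have hsL1 : 1 ≤ √L := Real.one_le_sqrt.2 hL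
  have hPL2 : P ≤ L ^ 2 := by
    rw [hPL]; nlinarith
  have hA : (2 * ((2 * v : ℕ) : ℝ) + 1) * 72 * β / n ≤ 216 * β / P := by
    have h1 : 2 * ((2 * v : ℕ) : ℝ) + 1 ≤ 3 * √n := by
      have h2 : 2 * v ≤ s := by omega
      have h2 : ((2 * v : ℕ) : ℝ) ≤ s := by exact_mod_cast h2
      have h3 : (s : ℝ) ≤ √n := Real.nat_sqrt_le_real_sqrt
      have h4 : 1 ≤ √(n : ℝ) := Real.one_le_sqrt.2 (by linarith)
      linarith
    have h2 : L ^ 2 ≤ √(n : ℝ) := Real.le_sqrt_of_sq_le (by rw [← pow_mul]; exact hn4)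
    have hsn : √(n : ℝ) * √n = n := Real.mul_self_sqrt hnpos.le
    have hsp : 0 < √(n : ℝ) := Real.sqrt_pos.2 hnpos
    calc _ ≤ (3 * √n) * 72 * β / n := by gcongr
      _ = 216 * β / √n := by
          rw [div_eq_div_iff hnpos.ne' hsp.ne']; linear_combination (216 * β) * hsn
      _ ≤ 216 * β / P := by
          gcongr
          exact hPL2.trans h2
  have hBd : 8 * (K / Hs v) ^ 2 * β * Real.log (1 + 9 * T / n) ≤ 128 * K ^ 2 * β / P := by
    calc _ ≤ 8 * (K / (L / 4)) ^ 2 * β * √L := by gcongr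
      _ = 128 * K ^ 2 * β * √L / L ^ 2 := by field_simp; ring
      _ = _ := by
          rw [div_eq_div_iff (by positivity) hP0.ne', hPL]
          calc _ = 128 * K ^ 2 * β * L * (√L * √L) := by ring
            _ = _ := by rw [hsL]; ring
  have hfin := integral_le_EE Pw hPw R T n (T + 2 * v + 2 * v) (by omega) hn1
    (D * T / P) (by positivity) (hb.trans (ENNReal.ofReal_le_ofReal (by
      calc _ ≤ 6 * (T : ℝ) * (216 * β / P + 128 * K ^ 2 * β / P) := by gcongr
        _ = _ := by rw [hD]; ring)))
  refine hfin.trans ?_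
  have hq : (Real.log T / 2) ^ ((3 : ℝ) / 2) ≤ P := by
    exact Real.rpow_le_rpow (by positivity) hLT (by norm_num)
  rw [Real.div_rpow hlT.le (by norm_num)] at hq
  calc D * T / P ≤ D * T / (Real.log T ^ ((3 : ℝ) / 2) / 2 ^ ((3 : ℝ) / 2)) := by gcongr
    _ = _ := by field_simp

theorem main_five (d : ℕ) (hd : 5 ≤ d) (Pw : Zd d → Measure (ℕ → Zd d)) (hPw : IsSRWFamily d Pw)
    (r : ℝ) (hr : 0 < r) :
    ∃ C : ℝ, 0 < C ∧ ∀ᶠ T : ℕ in atTop,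
      (∫ ω, (capTrunc Pw (walkRange ω 0 T) (r * T) -
          capacity Pw (walkRange ω 0 T)) ∂ (Pw 0)) ≤
        C * (T : ℝ) ^ ((3 : ℝ) / 4) := by
  obtain ⟨b, hb0, hpR⟩ := pR_upper d (by omega)
  set D := 6 * (144 * b) * 4 with hD
  have hD0 : 0 < D := by positivity
  refine ⟨D / r ^ ((1 : ℝ) / 4), by positivity, ?_⟩
  filter_upwards [ev_all r hr] with T ⟨hT, hL, hn1, hn2, h64, hll, hrL, hLT, hlT⟩
  set R := r * (T : ℝ) with hR
  set L := Real.log R with hLdef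
  set n := ⌊R / L ^ 10⌋₊ with hn
  obtain ⟨h2n, hnT, hn4, hlog, hsR, hnL⟩ := scale_facts r R L hr T n hT hR hL hn1 hn2 h64 hll hrL
  have hTR : (0 : ℝ) < T := by exact_mod_cast hT
  have hRpos : 0 < R := by positivity
  have hL0 : 0 < L := by linarith
  have hnR : (2 : ℝ) ≤ n := by exact_mod_cast h2n
  have hnpos : (0 : ℝ) < n := by linarith
  have hsp : 0 < √(n : ℝ) := Real.sqrt_pos.2 hnpos
  have hlog0 : 0 ≤ Real.log (1 + 9 * T / n) := Real.log_nonneg (by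
    have : (0 : ℝ) ≤ 9 * T / n := by positivity
    linarith)
  have hbd := real_bound (d := d) (by omega) (fun _ => True) 0 0 (fun _ _ _ => rfl) (fun η h => (h trivial).elim)
    (by simp) 1 (by norm_num) (fun y => by
      simp only [if_true, zero_add]
      rw [EE_const (by omega)]; simp) T n h2n (by omega) hnT (2 * b / √n) (by positivity)
    (fun t ht z => by
      refine (hpR t z).trans ?_
      have h1 : 1 ≤ √((t : ℝ) + 1) := Real.one_le_sqrt.2 (by
        have : (0 : ℝ) ≤ t := by positivity
        linarith)
      have h2 : √((t : ℝ) + 1) ^ 5 ≤ √((t : ℝ) + 1) ^ d := pow_le_pow_right₀ h1 hd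
      have h3 : √((t : ℝ) + 1) ^ 5 = ((t : ℝ) + 1) ^ 2 * √((t : ℝ) + 1) := by
        rw [show 5 = 2 * 2 + 1 by norm_num, pow_succ, pow_mul, Real.sq_sqrt (by positivity)]
      have h4 : √(n : ℝ) / 2 ≤ √((t : ℝ) + 1) := by
        refine Real.le_sqrt_of_sq_le ?_
        rw [div_pow, Real.sq_sqrt hnpos.le]
        have : n ≤ 2 * (t + 1) := by omega
        have : (n : ℝ) ≤ 2 * (t + 1) := by exact_mod_cast this
        linarith
      calc b / √((t : ℝ) + 1) ^ d ≤ b / (((t : ℝ) + 1) ^ 2 * (√n / 2)) := by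
            gcongr
            refine le_trans ?_ h2
            rw [h3]; gcongr
        _ = _ := by field_simp)
  have hsL1 : √L ≤ L := by
    rw [Real.sqrt_le_left hL0.le]; nlinarith
  have hinv : 1 / √(n : ℝ) ≤ 2 * L ^ 5 / √R := by
    have : L ^ 6 * (1 / √(n : ℝ)) ≤ L ^ 6 * (2 * L ^ 5 / √R) := by
      calc _ = L ^ 6 / √(n : ℝ) := by ring
        _ ≤ _ := hnL
        _ = _ := by ring
    exact le_of_mul_le_mul_left this (by positivity)
  set Q := R ^ ((1 : ℝ) / 4) with hQ
  have hQ0 : 0 < Q := by positivity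
  have hQQ : √R = Q * Q := by
    rw [hQ, ← Real.rpow_add hRpos, Real.sqrt_eq_rpow]; norm_num
  have hLQ : L ^ 6 ≤ Q := by
    have h1 : L ^ 24 ≤ R := by
      have : 0 ≤ L ^ 24 := by positivity
      linarith
    have h2 : (L ^ 24) ^ ((1 : ℝ) / 4) ≤ Q := Real.rpow_le_rpow (by positivity) h1 (by norm_num)
    have h3 : (L ^ 24) ^ ((1 : ℝ) / 4) = L ^ 6 := by
      rw [← Real.rpow_natCast, ← Real.rpow_natCast, ← Real.rpow_mul hL0.le]; norm_num
    rwa [h3] at h2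
  have hmain : (1 / √(n : ℝ)) * (1 + L) ≤ 4 / Q := by
    calc _ ≤ (2 * L ^ 5 / √R) * (L + L) := by gcongr
      _ = 4 * L ^ 6 / (Q * Q) := by rw [hQQ]; ring
      _ ≤ 4 * Q / (Q * Q) := by gcongr
      _ = 4 / Q := by field_simp
  have hfin := integral_le_EE Pw hPw R T n (T + 0 + 0) (by omega) hn1
    (D * T / Q) (by positivity) (hbd.trans (ENNReal.ofReal_le_ofReal (by
      calc _ ≤ 6 * (T : ℝ) * ((2 * 0 + 1) * 72 * (2 * b / √n) / 1 + 8 * 1 ^ 2 * (2 * b / √n) * L) := by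
            push_cast
            gcongr
            · linarith
            · exact hlog.trans hsL1
        _ ≤ 6 * (T : ℝ) * (144 * b * ((1 / √(n : ℝ)) * (1 + L))) := by
            gcongr
            have : 0 ≤ b / √n * L := by positivity
            have e1 : 2 * b / √(n : ℝ) = 2 * (b / √n) := by ring
            have e2 : 144 * b * ((1 / √(n : ℝ)) * (1 + L)) = 144 * (b / √n) + 144 * (b / √n * L) := by ring
            rw [e1, e2]; linarith
        _ ≤ 6 * (T : ℝ) * (144 * b * (4 / Q)) := by gcongr
        _ = _ := by rw [hD]; ring)))
  refine hfin.trans (le_of_eq ?_)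
  have hT4 : (T : ℝ) = (T : ℝ) ^ ((3 : ℝ) / 4) * (T : ℝ) ^ ((1 : ℝ) / 4) := by
    rw [← Real.rpow_add hTR]; norm_num
  rw [hQ, hR, Real.mul_rpow hr.le hTR.le]
  have : 0 < (T : ℝ) ^ ((1 : ℝ) / 4) := by positivity
  have : 0 < r ^ ((1 : ℝ) / 4) := by positivity
  rw [div_eq_iff (by positivity)]
  nth_rewrite 1 [hT4]
  field_simp

/-- Expected difference between truncated and ordinary capacity of the walk range:
`E^0[cap(X[0,T], rT) − cap(X[0,T])] ≤ C·T·(log T)^{-3/2}` for `d = 4`, and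
`≤ C·T^{3/4}` for `d ≥ 5`. -/
theorem truncated_capacity_difference
    (d : ℕ) (hd : 4 ≤ d)
    (Pw : Zd d → Measure (ℕ → Zd d)) (hPw : IsSRWFamily d Pw)
    (r : ℝ) (hr : 0 < r) :
    ∃ C : ℝ, 0 < C ∧ ∀ᶠ T : ℕ in atTop,
      (∫ ω, (capTrunc Pw (walkRange ω 0 T) (r * T) -
          capacity Pw (walkRange ω 0 T)) ∂ (Pw 0)) ≤
        if d = 4 then C * (T : ℝ) / (Real.log T) ^ ((3 : ℝ) / 2)
        else C * (T : ℝ) ^ ((3 : ℝ) / 4) := by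
  by_cases h : d = 4
  · subst h
    simpa using main_four Pw hPw r hr
  · simpa [h] using main_five d (by omega) Pw hPw r hr

end FRIPaper
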